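/- Let L(λ)=A+λB be a regular n×n complex symmetric matrix pencil (A=A^T, B=B^T) with pairwise distinct (finite or infinite) eigenvalues λ_1,…,λ_κ, where λ_i has partial multiplicities n_{i,1} ≥ … ≥ n_{i,g_i} > 0. Let r ≥ 1, let 0 ≤ s ≤ ⌊r/2⌋, set ℓ = r−2s, and let Φ_s : ℂ^{2ℓ+(r+s)n} → (n×n symmetric pencils) be the map defined in the context. Then there exists a generic set G_s ⊆ ℂ^{2ℓ+(r+s)n} such that for every x ∈ G_s, writing E = Φ_s(x): (a) L+E is a regular pencil; (b) for each i = 1,…,κ, the partial multiplicities of L+E at λ_i are exactly n_{i,r+1} ≥ … ≥ n_{i,g_i} (in particular, if r ≥ g_i then λ_i is not an eigenvalue of L+E); (c) every (finite or infinite) eigenvalue of L+E that is not an eigenvalue of L is simple. -/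

import Mathlib

open Matrix Polynomial BigOperators

/-- The determinant of the pencil `A + λ B`, as a polynomial in `λ`. -/
noncomputable def pencilPoly (n : ℕ) (A B : Matrix (Fin n) (Fin n) ℂ) : Polynomial ℂ :=
  (A.map Polynomial.C + (Polynomial.X : Polynomial ℂ) • B.map Polynomial.C).det

/-- A pencil is regular if its determinant is not the zero polynomial. -/
def PencilRegular (n : ℕ) (A B : Matrix (Fin n) (Fin n) ℂ) : Prop :=
  pencilPoly n A B ≠ 0

/-- The order of vanishing of a polynomial at a point (`⊤` for the zero polynomial). -/
noncomputable def orderVan (p : Polynomial ℂ) (z : ℂ) : ℕ∞ :=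
  if p = 0 then ⊤ else (p.rootMultiplicity z : ℕ∞)

/-- `m_k(z)`: the minimum over all `k × k` submatrices `S(λ)` of `A + λB` of the order
of vanishing of `det S(λ)` at `z`. -/
noncomputable def minorOrder (n k : ℕ) (A B : Matrix (Fin n) (Fin n) ℂ) (z : ℂ) : ℕ∞ :=
  ⨅ (f : Fin k ↪ Fin n) (g : Fin k ↪ Fin n),
    orderVan (((A.map Polynomial.C + (Polynomial.X : Polynomial ℂ) • B.map Polynomial.C).submatrix f g).det) z

/-- The multiset of partial multiplicities of the pencil `A + λB` at the finite point
`z`: the positive values among `m_k(z) − m_{k−1}(z)`, `k = 1, …, n`. -/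
noncomputable def pmFin (n : ℕ) (A B : Matrix (Fin n) (Fin n) ℂ) (z : ℂ) : Multiset ℕ :=
  ((Multiset.range n).map fun k =>
    (minorOrder n (k + 1) A B z - minorOrder n k A B z).toNat).filter (fun m => 0 < m)

/-- The multiset of partial multiplicities of the pencil `A + λB` at a finite point
(`some z`) or at infinity (`none`, via the reversal pencil `B + λA` at `0`). -/
noncomputable def pmAt (n : ℕ) (A B : Matrix (Fin n) (Fin n) ℂ) : Option ℂ → Multiset ℕ
  | some z => pmFin n A B z
  | none => pmFin n B A 0

/-- `μ` (finite or infinite) is an eigenvalue of the pencil `A + λB` iff the list of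
partial multiplicities at `μ` is nonempty. -/
def IsEigenvalue (n : ℕ) (A B : Matrix (Fin n) (Fin n) ℂ) (μ : Option ℂ) : Prop :=
  pmAt n A B μ ≠ 0

/-- The algebraic multiplicity of a finite (`some z`) or infinite (`none`) eigenvalue. -/
noncomputable def algMultAt (n : ℕ) (A B : Matrix (Fin n) (Fin n) ℂ) : Option ℂ → ℕ
  | some z => (pencilPoly n A B).rootMultiplicity z
  | none => (pencilPoly n B A).rootMultiplicity 0

/-- A subset of `ι → ℂ` (i.e. `ℂ^N`, `N = #ι`) is generic if its complement is
contained in the common zero set of finitely many polynomials that are not all zero. -/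
def IsGenericC (ι : Type) [Fintype ι] (G : Set (ι → ℂ)) : Prop :=
  ∃ S : Finset (MvPolynomial ι ℂ), (∃ p ∈ S, p ≠ 0) ∧
    Gᶜ ⊆ { x | ∀ p ∈ S, MvPolynomial.eval x p = 0 }

/-- A subset of `ι → ℝ` (i.e. `ℝ^N`, `N = #ι`) is generic if its complement is
contained in the common zero set of finitely many real polynomials that are not all zero. -/
def IsGenericR (ι : Type) [Fintype ι] (G : Set (ι → ℝ)) : Prop :=
  ∃ S : Finset (MvPolynomial ι ℝ), (∃ p ∈ S, p ≠ 0) ∧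
    Gᶜ ⊆ { x | ∀ p ∈ S, MvPolynomial.eval x p = 0 }

/-- Index type for the coordinates of the vectors
`u_1,…,u_ℓ, v_1,…,v_s, γ_1,…,γ_s, δ_1,…,δ_s ∈ ℂ^n` ((ℓ + 3s)n = (r+s)n coordinates). -/
abbrev IdxC (l s n : ℕ) : Type := (Fin l ⊕ (Fin s ⊕ Fin s ⊕ Fin s)) × Fin n

/-- Parameter space `ℂ^{2ℓ+(r+s)n}` for the symmetric parameterization `Φ_s`:
the complex numbers `a_1, b_1, …, a_ℓ, b_ℓ` and the vector coordinates. -/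
abbrev IdxS (l s n : ℕ) : Type := (Fin l ⊕ Fin l) ⊕ IdxC l s n

/-- Constant coefficient of the symmetric pencil
`Φ_s(x)(λ) = Σ_i (a_i + λ b_i) u_i u_iᵀ + Σ_j (v_j (γ_j + λ δ_j)ᵀ + (γ_j + λ δ_j) v_jᵀ)`. -/
noncomputable def PhiSymA (n l s : ℕ) (x : IdxS l s n → ℂ) : Matrix (Fin n) (Fin n) ℂ :=
  (∑ i : Fin l,
    x (.inl (.inl i)) •
      Matrix.vecMulVec (fun k => x (.inr (.inl i, k))) (fun k => x (.inr (.inl i, k))))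
  + ∑ j : Fin s,
      (Matrix.vecMulVec (fun k => x (.inr (.inr (.inl j), k)))
          (fun k => x (.inr (.inr (.inr (.inl j)), k)))
        + Matrix.vecMulVec (fun k => x (.inr (.inr (.inr (.inl j)), k)))
            (fun k => x (.inr (.inr (.inl j), k))))

/-- Coefficient of `λ` in the symmetric pencil `Φ_s(x)(λ)`. -/
noncomputable def PhiSymB (n l s : ℕ) (x : IdxS l s n → ℂ) : Matrix (Fin n) (Fin n) ℂ :=
  (∑ i : Fin l,
    x (.inl (.inr i)) •
      Matrix.vecMulVec (fun k => x (.inr (.inl i, k))) (fun k => x (.inr (.inl i, k))))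
  + ∑ j : Fin s,
      (Matrix.vecMulVec (fun k => x (.inr (.inr (.inl j), k)))
          (fun k => x (.inr (.inr (.inr (.inr j)), k)))
        + Matrix.vecMulVec (fun k => x (.inr (.inr (.inr (.inr j)), k)))
            (fun k => x (.inr (.inr (.inl j), k))))

/-- The number of elements of `s` that are at least `j`. -/
def cntGE (s : Multiset ℕ) (j : ℕ) : ℕ := (s.filter (j ≤ ·)).card

/-- The sum of the elements of `s` after its `r` largest ones have been removed. -/
def sumDrop (r : ℕ) (s : Multiset ℕ) : ℕ :=
  ∑ j ∈ Finset.range s.sum, (cntGE s (j + 1) - r)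

lemma cntGE_cons (a : ℕ) (s : Multiset ℕ) (j : ℕ) :
    cntGE (a ::ₘ s) j = (if j ≤ a then 1 else 0) + cntGE s j := by
  unfold cntGE
  rw [Multiset.filter_cons]
  split_ifs <;> simp [add_comm]

lemma cntGE_eq_zero {s : Multiset ℕ} {j : ℕ} (h : ∀ a ∈ s, a < j) : cntGE s j = 0 := by
  unfold cntGE
  rw [Multiset.card_eq_zero, Multiset.filter_eq_nil]
  intro a ha
  exact not_le.mpr (h a ha)

lemma sum_cntGE (s : Multiset ℕ) (N : ℕ) (h : ∀ a ∈ s, a ≤ N) :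
    ∑ j ∈ Finset.range N, cntGE s (j + 1) = s.sum := by
  induction s using Multiset.induction_on with
  | empty => simp [cntGE]
  | cons a s ih =>
    simp only [cntGE_cons, Finset.sum_add_distrib, Multiset.sum_cons]
    rw [ih fun b hb => h b (Multiset.mem_cons_of_mem hb), ← Finset.card_filter]
    congr 1
    have : (Finset.range N).filter (fun j => j + 1 ≤ a) = Finset.range a := by
      ext j
      have := h a (Multiset.mem_cons_self a s)
      simp only [Finset.mem_filter, Finset.mem_range]
      omega
    rw [this, Finset.card_range]

lemma sumDrop_eq (r : ℕ) (s : Multiset ℕ) (N : ℕ) (h : ∀ a ∈ s, a ≤ N) :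
    sumDrop r s = ∑ j ∈ Finset.range N, (cntGE s (j + 1) - r) := by
  have key : ∀ K : ℕ, (∀ a ∈ s, a ≤ K) → ∀ K', K ≤ K' →
      ∑ j ∈ Finset.range K, (cntGE s (j + 1) - r)
        = ∑ j ∈ Finset.range K', (cntGE s (j + 1) - r) := by
    intro K hK K' hKK'
    refine Finset.sum_subset (Finset.range_subset_range.mpr hKK') fun j _ hj => ?_
    rw [cntGE_eq_zero, Nat.zero_sub]
    intro a ha
    have := hK a ha
    simp only [Finset.mem_range] at hj
    omega
  unfold sumDrop
  rw [key _ (fun a ha => Multiset.le_sum_of_mem ha) (max N s.sum) (le_max_right _ _),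
    key N h (max N s.sum) (le_max_left _ _)]

lemma sumDrop_one_cons {a : ℕ} {s : Multiset ℕ} (h : ∀ b ∈ s, b ≤ a) :
    sumDrop 1 (a ::ₘ s) = s.sum := by
  have h' : ∀ b ∈ a ::ₘ s, b ≤ a := by
    intro b hb
    rcases Multiset.mem_cons.mp hb with rfl | hb
    exacts [le_rfl, h b hb]
  rw [sumDrop_eq 1 _ a h', ← sum_cntGE s a h]
  refine Finset.sum_congr rfl fun j hj => ?_
  have : j + 1 ≤ a := Finset.mem_range.mp hj
  rw [cntGE_cons, if_pos this, Nat.add_sub_cancel_left]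

lemma sumDrop_le_sum {r : ℕ} {s s' : Multiset ℕ}
    (h : ∀ j, cntGE s (j + 1) ≤ cntGE s' (j + 1) + r) : sumDrop r s ≤ s'.sum := by
  have h1 : ∀ a ∈ s, a ≤ s.sum + s'.sum := fun a ha =>
    (Multiset.le_sum_of_mem ha).trans (Nat.le_add_right _ _)
  have h2 : ∀ a ∈ s', a ≤ s.sum + s'.sum := fun a ha =>
    (Multiset.le_sum_of_mem ha).trans (Nat.le_add_left _ _)
  have h3 := sum_cntGE s' _ h2
  rw [sumDrop_eq r s _ h1]
  refine le_trans ?_ h3.le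
  exact Finset.sum_le_sum fun j _ => Nat.sub_le_iff_le_add.mpr (h j)

lemma cntGE_eq_of_sum_eq {r : ℕ} {s s' : Multiset ℕ}
    (h : ∀ j, cntGE s (j + 1) ≤ cntGE s' (j + 1) + r) (hsum : s'.sum = sumDrop r s) (j : ℕ) :
    cntGE s' (j + 1) = cntGE s (j + 1) - r := by
  have h1 : ∀ a ∈ s, a ≤ s.sum + s'.sum + j + 1 := fun a ha =>
    (Multiset.le_sum_of_mem ha).trans (by omega)
  have h2 : ∀ a ∈ s', a ≤ s.sum + s'.sum + j + 1 := fun a ha =>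
    (Multiset.le_sum_of_mem ha).trans (by omega)
  have h3 := sum_cntGE s' _ h2
  have h4 := sumDrop_eq r s _ h1
  exact ((Finset.sum_eq_sum_iff_of_le fun i _ => Nat.sub_le_iff_le_add.mpr (h i)).mp
    (h4.symm.trans (hsum.symm.trans h3.symm)) j (Finset.mem_range.mpr (by omega))).symm

lemma sumDrop_add {r : ℕ} {s s' : Multiset ℕ}
    (h : ∀ j, cntGE s' (j + 1) = cntGE s (j + 1) - r) (t : ℕ) :
    sumDrop t s' = sumDrop (r + t) s := by
  have h1 : ∀ a ∈ s, a ≤ s.sum + s'.sum := fun a ha =>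
    (Multiset.le_sum_of_mem ha).trans (Nat.le_add_right _ _)
  have h2 : ∀ a ∈ s', a ≤ s.sum + s'.sum := fun a ha =>
    (Multiset.le_sum_of_mem ha).trans (Nat.le_add_left _ _)
  rw [sumDrop_eq _ s _ h1, sumDrop_eq _ s' _ h2]
  refine Finset.sum_congr rfl fun j _ => ?_
  rw [h, Nat.sub_sub]

lemma eq_of_cntGE_eq {s s' : Multiset ℕ} (hs : ∀ a ∈ s, 0 < a) (hs' : ∀ a ∈ s', 0 < a)
    (h : ∀ j, cntGE s (j + 1) = cntGE s' (j + 1)) : s = s' := by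
  have key : ∀ (t : Multiset ℕ) (j : ℕ), cntGE t j = t.count j + cntGE t (j + 1) := by
    intro t j
    induction t using Multiset.induction_on with
    | empty => simp [cntGE]
    | cons a t ih =>
      rw [cntGE_cons, cntGE_cons, Multiset.count_cons, ih]
      split_ifs <;> omega
  ext a
  rcases Nat.eq_zero_or_pos a with rfl | ha
  · rw [Multiset.count_eq_zero.mpr fun h0 => lt_irrefl 0 (hs 0 h0),
      Multiset.count_eq_zero.mpr fun h0 => lt_irrefl 0 (hs' 0 h0)]
  · obtain ⟨b, rfl⟩ : ∃ b, a = b + 1 := ⟨a - 1, by omega⟩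
    have h1 := key s (b + 1)
    have h2 := key s' (b + 1)
    rw [h b, h (b + 1)] at h1
    omega

lemma cntGE_map_range {f : ℕ → ℕ} (hf : ∀ j k, j ≤ k → f k ≤ f j) (g r j : ℕ) :
    cntGE ((Multiset.range (g - r)).map fun i => f (r + i)) j
      = cntGE ((Multiset.range g).map f) j - r := by
  have key : ∀ (f : ℕ → ℕ) (g : ℕ), cntGE ((Multiset.range g).map f) j
      = ((Finset.range g).filter fun i => j ≤ f i).card := by
    intro f g
    rw [cntGE, Multiset.filter_map, Multiset.card_map]
    rfl
  rw [key, key]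
  by_cases hr : j ≤ f r ∧ r ≤ g
  · have h1 : (Finset.range g).filter (fun i => j ≤ f i)
        = Finset.range r ∪ ((Finset.range (g - r)).filter fun i => j ≤ f (r + i)).map
            (addLeftEmbedding r) := by
      ext i
      simp only [Finset.mem_filter, Finset.mem_range, Finset.mem_union, Finset.mem_map,
        addLeftEmbedding_apply]
      constructor
      · rintro ⟨h1, h2⟩
        by_cases hi : i < r
        · exact Or.inl hi
        · refine Or.inr ⟨i - r, ⟨by omega, ?_⟩, by omega⟩
          rwa [Nat.add_sub_cancel' (not_lt.mp hi)]
      · rintro (hi | ⟨k, ⟨hk1, hk2⟩, rfl⟩)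
        · exact ⟨by omega, hr.1.trans (hf _ _ hi.le)⟩
        · exact ⟨by omega, hk2⟩
    rw [h1, Finset.card_union_of_disjoint, Finset.card_range, Finset.card_map,
      Nat.add_sub_cancel_left]
    rw [Finset.disjoint_left]
    intro i hi hi'
    simp only [Finset.mem_range, Finset.mem_map, addLeftEmbedding_apply] at hi hi'
    obtain ⟨k, -, rfl⟩ := hi'
    omega
  · have h1 : ((Finset.range (g - r)).filter fun i => j ≤ f (r + i)) = ∅ := by
      rw [Finset.filter_eq_empty_iff]
      intro i hi hj
      rw [Finset.mem_range] at hi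
      exact hr ⟨hj.trans (hf _ _ (Nat.le_add_right r i)), by omega⟩
    rw [h1, Finset.card_empty, eq_comm, Nat.sub_eq_zero_iff_le]
    have h2 : (Finset.range g).filter (fun i => j ≤ f i) ⊆ Finset.range r := by
      intro i hi
      simp only [Finset.mem_filter, Finset.mem_range] at hi ⊢
      by_contra hir
      exact hr ⟨hi.2.trans (hf _ _ (not_lt.mp hir)), by omega⟩
    simpa using Finset.card_le_card h2

/-- The polynomial matrix `A + λ B`. -/
noncomputable def pencil {n : ℕ} (A B : Matrix (Fin n) (Fin n) ℂ) :
    Matrix (Fin n) (Fin n) ℂ[X] :=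
  A.map Polynomial.C + (Polynomial.X : ℂ[X]) • B.map Polynomial.C

/-- Diagonalization of a nonsingular matrix over a principal ideal domain by unimodular
row and column operations. -/
lemma exists_diagonalization {R : Type*} [CommRing R] [IsDomain R] [IsPrincipalIdealRing R]
    {n : ℕ} (P : Matrix (Fin n) (Fin n) R) (hP : P.det ≠ 0) :
    ∃ (Q Q' : Matrix (Fin n) (Fin n) R) (d : Fin n → R),
      IsUnit Q ∧ IsUnit Q' ∧ P = Q * diagonal d * Q' ∧ ∀ i, d i ≠ 0 := by
  have hinj : Function.Injective P.mulVecLin := by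
    rw [← LinearMap.ker_eq_bot, LinearMap.ker_eq_bot']
    intro v hv
    exact Matrix.eq_zero_of_mulVec_eq_zero hP hv
  let b := Pi.basisFun R (Fin n)
  let bN : Module.Basis (Fin n) R (LinearMap.range P.mulVecLin) :=
    b.map (LinearEquiv.ofInjective P.mulVecLin hinj)
  have hrank : Module.finrank R (LinearMap.range P.mulVecLin)
      = Module.finrank R (Fin n → R) := by
    rw [Module.finrank_eq_card_basis bN, Module.finrank_eq_card_basis b]
  obtain ⟨b', a, ab, hab⟩ := Submodule.exists_smith_normal_form_of_rank_eq b hrank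
  have hQ : IsUnit (b.toMatrix b') :=
    (Matrix.isUnit_iff_isUnit_det _).mpr (b.isUnit_det b')
  have hQ' : IsUnit (ab.toMatrix bN) :=
    (Matrix.isUnit_iff_isUnit_det _).mpr (ab.isUnit_det bN)
  have hPeq : P = b.toMatrix b' * diagonal a * ab.toMatrix bN := by
    ext i j
    have h1 : ∑ k, ab.toMatrix bN k j • ab k = bN j := ab.sum_toMatrix_smul_self _ _
    have h2 := congrArg (fun x : LinearMap.range P.mulVecLin => (x : Fin n → R) i) h1
    have h3 : ((bN j : LinearMap.range P.mulVecLin) : Fin n → R) i = P i j := by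
      simp [bN, b]
    simp only [h3] at h2
    rw [← h2, Matrix.mul_apply]
    simp only [Matrix.mul_diagonal, Submodule.coe_sum, Submodule.coe_smul, hab,
      Finset.sum_apply, Pi.smul_apply, smul_eq_mul, Module.Basis.toMatrix_apply, b,
      Pi.basisFun_repr]
    exact Finset.sum_congr rfl fun k _ => by ring
  refine ⟨_, _, a, hQ, hQ', hPeq, fun i hi => hP ?_⟩
  rw [hPeq, det_mul, det_mul, det_diagonal, Finset.prod_eq_zero (Finset.mem_univ i) hi]
  simp

lemma le_orderVan_iff (p : ℂ[X]) (z : ℂ) (m : ℕ) :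
    (m : ℕ∞) ≤ orderVan p z ↔ (X - C z) ^ m ∣ p := by
  unfold orderVan
  split_ifs with h
  · simp [h]
  · rw [Nat.cast_le, Polynomial.le_rootMultiplicity_iff h]

lemma le_minorOrder_iff {n k : ℕ} (A B : Matrix (Fin n) (Fin n) ℂ) (z : ℂ) (m : ℕ) :
    (m : ℕ∞) ≤ minorOrder n k A B z ↔
      ∀ f g : Fin k ↪ Fin n, (X - C z) ^ m ∣ ((pencil A B).submatrix f g).det := by
  simp only [minorOrder, le_iInf_iff, le_orderVan_iff, pencil]

section Minors

variable {R : Type*} [CommRing R] {n k : ℕ}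

lemma dvd_det_submatrix_of_embedding {a : R} {M : Matrix (Fin n) (Fin n) R}
    (h : ∀ f g : Fin k ↪ Fin n, a ∣ (M.submatrix f g).det) (f g : Fin k → Fin n) :
    a ∣ (M.submatrix f g).det := by
  by_cases hf : Function.Injective f
  · by_cases hg : Function.Injective g
    · exact h ⟨f, hf⟩ ⟨g, hg⟩
    · obtain ⟨i, j, hij, hne⟩ := Function.not_injective_iff.mp hg
      rw [det_zero_of_column_eq hne fun l => by simp [hij]]
      exact dvd_zero a
  · obtain ⟨i, j, hij, hne⟩ := Function.not_injective_iff.mp hf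
    rw [det_zero_of_row_eq hne (by ext l; simp [hij])]
    exact dvd_zero a

lemma dvd_det_submatrix_mul_left {a : R} (Q : Matrix (Fin n) (Fin n) R)
    {M : Matrix (Fin n) (Fin n) R}
    (h : ∀ f g : Fin k → Fin n, a ∣ (M.submatrix f g).det) (f g : Fin k → Fin n) :
    a ∣ ((Q * M).submatrix f g).det := by
  have h1 : (Q * M).submatrix f g
      = fun i => ∑ l : Fin n, Q (f i) l • fun j => M l (g j) := by
    ext i j
    simp [Matrix.mul_apply]
  have h2 : ((Q * M).submatrix f g).det = ∑ t : Fin k → Fin n,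
      (∏ i, Q (f i) (t i)) • (M.submatrix t g).det := by
    rw [h1]
    change detRowAlternating (R := R) (n := Fin k) _ = _
    rw [← AlternatingMap.coe_multilinearMap, MultilinearMap.map_sum]
    refine Finset.sum_congr rfl fun t _ => ?_
    rw [MultilinearMap.map_smul_univ]
    rfl
  rw [h2]
  exact Finset.dvd_sum fun t _ => Dvd.dvd.mul_left (h t g) _

lemma dvd_det_submatrix_mul_right {a : R} (Q : Matrix (Fin n) (Fin n) R)
    {M : Matrix (Fin n) (Fin n) R}
    (h : ∀ f g : Fin k → Fin n, a ∣ (M.submatrix f g).det) (f g : Fin k → Fin n) :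
    a ∣ ((M * Q).submatrix f g).det := by
  have := dvd_det_submatrix_mul_left (a := a) Qᵀ (M := Mᵀ)
    (fun f g => by rw [← transpose_submatrix, det_transpose]; exact h g f) g f
  rwa [← transpose_mul, ← transpose_submatrix, det_transpose] at this

end Minors

lemma sum_le_sum_of_monotone {n k : ℕ} {e : Fin n → ℕ} (he : Monotone e) (hk : k ≤ n)
    (g : Fin k ↪ Fin n) : ∑ i : Fin k, e (Fin.castLE hk i) ≤ ∑ i : Fin k, e (g i) := by
  have hc : (Finset.univ.map g).card = k := by simp
  have h1 : ∑ i : Fin k, e (g i) = ∑ x ∈ Finset.univ.map g, e x := by simp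
  have h2 : ∑ x ∈ Finset.univ.map g, e x
      = ∑ i : Fin k, e ((Finset.univ.map g).orderEmbOfFin hc i) := by
    conv_lhs => rw [← Finset.map_orderEmbOfFin_univ _ hc, Finset.sum_map]
    rfl
  rw [h1, h2]
  refine Finset.sum_le_sum fun i _ => he ?_
  have hmono := ((Finset.univ.map g).orderEmbOfFin hc).strictMono
  have : ∀ m (hm : m < k), m ≤ ((Finset.univ.map g).orderEmbOfFin hc ⟨m, hm⟩ : ℕ) := by
    intro m
    induction m with
    | zero => intro _; exact Nat.zero_le _
    | succ m ih =>
      intro hm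
      have h3 := ih (by omega)
      have h4 : (Finset.univ.map g).orderEmbOfFin hc ⟨m, by omega⟩
        < (Finset.univ.map g).orderEmbOfFin hc ⟨m + 1, hm⟩ := hmono (by simp [Fin.lt_def])
      rw [Fin.lt_def] at h4
      omega
  exact this i i.2

lemma rootMultiplicity_finset_prod {ι : Type*} (s : Finset ι) {f : ι → ℂ[X]}
    (hf : ∀ i ∈ s, f i ≠ 0) (z : ℂ) :
    (∏ i ∈ s, f i).rootMultiplicity z = ∑ i ∈ s, (f i).rootMultiplicity z := by
  classical
  induction s using Finset.induction_on with
  | empty => simp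
  | insert a s ha ih =>
    have h1 : ∀ i ∈ s, f i ≠ 0 := fun i hi => hf i (Finset.mem_insert_of_mem hi)
    rw [Finset.prod_insert ha, Finset.sum_insert ha, rootMultiplicity_mul, ih h1]
    exact mul_ne_zero (hf a (Finset.mem_insert_self a s)) (Finset.prod_ne_zero_iff.mpr h1)

lemma minorOrder_eq_sum {n k : ℕ} {A B : Matrix (Fin n) (Fin n) ℂ}
    {Q Q' : Matrix (Fin n) (Fin n) ℂ[X]} {d : Fin n → ℂ[X]} (hQ : IsUnit Q) (hQ' : IsUnit Q')
    (hP : pencil A B = Q * diagonal d * Q') (hd : ∀ i, d i ≠ 0) {z : ℂ}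
    (he : Monotone fun i => (d i).rootMultiplicity z) (hk : k ≤ n) :
    minorOrder n k A B z
      = ((∑ i : Fin k, (d (Fin.castLE hk i)).rootMultiplicity z : ℕ) : ℕ∞) := by
  refine le_antisymm ?_ ?_
  · by_contra hlt
    rw [not_le] at hlt
    have h1 := Order.add_one_le_of_lt hlt
    rw [← Nat.cast_one, ← Nat.cast_add, le_minorOrder_iff] at h1
    have h2 := dvd_det_submatrix_of_embedding h1
    obtain ⟨⟨R, R1, hR1, hR2⟩, rfl⟩ := hQ
    obtain ⟨⟨R', R1', hR1', hR2'⟩, rfl⟩ := hQ'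
    have h3 := dvd_det_submatrix_mul_right R1' (dvd_det_submatrix_mul_left R1 h2)
    have h4 : R1 * pencil A B * R1' = diagonal d := by
      rw [hP]
      simp only [← Matrix.mul_assoc]
      rw [hR2, Matrix.one_mul, Matrix.mul_assoc, hR1', Matrix.mul_one]
    rw [h4] at h3
    have h5 := h3 (Fin.castLE hk) (Fin.castLE hk)
    rw [submatrix_diagonal _ _ (Fin.castLE_injective hk), det_diagonal] at h5
    have hne : ∏ i : Fin k, (d ∘ Fin.castLE hk) i ≠ 0 :=
      Finset.prod_ne_zero_iff.mpr fun i _ => hd _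
    rw [← le_rootMultiplicity_iff hne] at h5
    have h6 : (∏ i : Fin k, (d ∘ Fin.castLE hk) i).rootMultiplicity z
        = ∑ i : Fin k, (d (Fin.castLE hk i)).rootMultiplicity z := by
      exact rootMultiplicity_finset_prod _ (fun i _ => hd _) z
    omega
  · rw [le_minorOrder_iff]
    intro f g
    rw [hP]
    refine dvd_det_submatrix_mul_right Q' (dvd_det_submatrix_mul_left Q
      (dvd_det_submatrix_of_embedding fun f g => ?_)) f g
    rw [det_apply']
    refine Finset.dvd_sum fun σ _ => Dvd.dvd.mul_left ?_ _
    refine (pow_dvd_pow _ (sum_le_sum_of_monotone he hk g)).trans ?_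
    rw [← Finset.prod_pow_eq_pow_sum]
    refine Finset.prod_dvd_prod_of_dvd _ _ fun i _ => ?_
    rw [submatrix_apply, diagonal_apply]
    split_ifs with h
    · rw [h]
      exact pow_rootMultiplicity_dvd _ _
    · exact dvd_zero _

lemma pmFin_eq_of_monotone {n : ℕ} {A B : Matrix (Fin n) (Fin n) ℂ}
    {Q Q' : Matrix (Fin n) (Fin n) ℂ[X]} {d : Fin n → ℂ[X]} (hQ : IsUnit Q) (hQ' : IsUnit Q')
    (hP : pencil A B = Q * diagonal d * Q') (hd : ∀ i, d i ≠ 0) {z : ℂ}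
    (he : Monotone fun i => (d i).rootMultiplicity z) :
    pmFin n A B z
      = (Finset.univ.val.map fun i => (d i).rootMultiplicity z).filter (0 < ·) := by
  unfold pmFin
  congr 1
  have hrange : Multiset.range n = (Finset.univ : Finset (Fin n)).val.map Fin.val := by
    have : Finset.range n = (Finset.univ : Finset (Fin n)).map Fin.valEmbedding := by
      ext i
      simp
    exact congrArg Finset.val this
  rw [hrange, Multiset.map_map]
  refine Multiset.map_congr rfl fun i _ => ?_
  have h1 := minorOrder_eq_sum hQ hQ' hP hd he (Nat.succ_le_of_lt i.2)
  have h2 := minorOrder_eq_sum hQ hQ' hP hd he i.2.le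
  simp only [Function.comp_apply]
  rw [show (i : ℕ) + 1 = (i : ℕ).succ from rfl, h1, h2, Fin.sum_univ_castSucc]
  norm_cast
  simp only [Fin.castLE_castSucc, ENat.toNat_natCast]
  rw [Nat.add_sub_cancel_left]
  rfl

lemma pmFin_eq {n : ℕ} {A B : Matrix (Fin n) (Fin n) ℂ}
    {Q Q' : Matrix (Fin n) (Fin n) ℂ[X]} {d : Fin n → ℂ[X]} (hQ : IsUnit Q) (hQ' : IsUnit Q')
    (hP : pencil A B = Q * diagonal d * Q') (hd : ∀ i, d i ≠ 0) (z : ℂ) :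
    pmFin n A B z
      = (Finset.univ.val.map fun i => (d i).rootMultiplicity z).filter (0 < ·) := by
  let σ := Tuple.sort fun i => (d i).rootMultiplicity z
  have hmono : Monotone fun i => ((d ∘ σ) i).rootMultiplicity z :=
    Tuple.monotone_sort fun i => (d i).rootMultiplicity z
  have hQ1 : IsUnit (Q.submatrix id σ) := by
    rw [isUnit_iff_isUnit_det, det_permute', IsUnit.mul_iff]
    exact ⟨(Units.isUnit _).map (Int.castRingHom ℂ[X]),
      (isUnit_iff_isUnit_det _).mp hQ⟩
  have hQ2 : IsUnit (Q'.submatrix σ id) := by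
    rw [isUnit_iff_isUnit_det, det_permute, IsUnit.mul_iff]
    exact ⟨(Units.isUnit _).map (Int.castRingHom ℂ[X]),
      (isUnit_iff_isUnit_det _).mp hQ'⟩
  have hP' : pencil A B = Q.submatrix id σ * diagonal (d ∘ σ) * Q'.submatrix σ id := by
    rw [← submatrix_diagonal_equiv, submatrix_mul_equiv, submatrix_mul_equiv, ← hP,
      submatrix_id_id]
  rw [pmFin_eq_of_monotone hQ1 hQ2 hP' (fun i => hd _) hmono]
  congr 1
  have : (Finset.univ : Finset (Fin n)).val.map σ = Finset.univ.val := by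
    simp
  conv_rhs => rw [← this, Multiset.map_map]
  rfl

lemma cntGE_filter_pos (s : Multiset ℕ) (j : ℕ) :
    cntGE (s.filter (0 < ·)) (j + 1) = cntGE s (j + 1) := by
  unfold cntGE
  rw [Multiset.filter_filter]
  congr 1
  exact Multiset.filter_congr fun a _ => by omega

lemma sumDrop_filter_pos (r : ℕ) (s : Multiset ℕ) :
    sumDrop r (s.filter (0 < ·)) = sumDrop r s := by
  simpa using sumDrop_add (r := 0) (s := s) (s' := s.filter (0 < ·))
    (fun j => by simp [cntGE_filter_pos]) r

lemma sum_filter_pos (s : Multiset ℕ) : (s.filter (0 < ·)).sum = s.sum := by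
  induction s using Multiset.induction_on with
  | empty => rfl
  | cons a s ih =>
    rw [Multiset.filter_cons]
    split_ifs with h
    · simp [ih]
    · have : a = 0 := by omega
      simp [ih, this]

lemma rootMultiplicity_det {n : ℕ} {P Q Q' : Matrix (Fin n) (Fin n) ℂ[X]} {d : Fin n → ℂ[X]}
    (hQ : IsUnit Q) (hQ' : IsUnit Q') (hP : P = Q * diagonal d * Q') (hd : ∀ i, d i ≠ 0)
    (z : ℂ) : P.det.rootMultiplicity z
      = (Finset.univ.val.map fun i => (d i).rootMultiplicity z).sum := by
  have hunit : ∀ u : ℂ[X], IsUnit u → u.rootMultiplicity z = 0 := by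
    intro u hu
    obtain ⟨c, -, rfl⟩ := Polynomial.isUnit_iff.mp hu
    exact rootMultiplicity_C c z
  have hprod : ∏ i, d i ≠ 0 := Finset.prod_ne_zero_iff.mpr fun i _ => hd i
  have h1 := (isUnit_iff_isUnit_det _).mp hQ
  have h2 := (isUnit_iff_isUnit_det _).mp hQ'
  rw [hP, det_mul, det_mul, det_diagonal, rootMultiplicity_mul, rootMultiplicity_mul,
    hunit _ h1, hunit _ h2, rootMultiplicity_finset_prod _ fun i _ => hd i]
  · rw [zero_add, add_zero]
    rfl
  · exact mul_ne_zero h1.ne_zero hprod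
  · exact mul_ne_zero (mul_ne_zero h1.ne_zero hprod) h2.ne_zero

/-- The partial multiplicities at a point add up to the algebraic multiplicity. -/
lemma sum_pmFin {n : ℕ} {A B : Matrix (Fin n) (Fin n) ℂ} (h : pencilPoly n A B ≠ 0) (z : ℂ) :
    (pmFin n A B z).sum = (pencilPoly n A B).rootMultiplicity z := by
  obtain ⟨Q, Q', d, hQ, hQ', hP, hd⟩ := exists_diagonalization (pencil A B) h
  rw [pmFin_eq hQ hQ' hP hd, sum_filter_pos, ← rootMultiplicity_det hQ hQ' hP hd]
  rfl

lemma matrix_rank_add_le {m n : Type*} [Fintype m] [Fintype n] (M N : Matrix m n ℂ) :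
    (M + N).rank ≤ M.rank + N.rank := by
  unfold Matrix.rank
  have h : LinearMap.range (M + N).mulVecLin
      ≤ LinearMap.range M.mulVecLin ⊔ LinearMap.range N.mulVecLin := by
    rintro _ ⟨v, rfl⟩
    rw [Matrix.mulVecLin_add, LinearMap.add_apply]
    exact Submodule.add_mem_sup ⟨v, rfl⟩ ⟨v, rfl⟩
  exact (Submodule.finrank_mono h).trans (Submodule.finrank_add_le_finrank_add_finrank _ _)

lemma exists_eval_ne_zero {p : ℂ[X]} (hp : p ≠ 0) : ∃ x, p.eval x ≠ 0 := by
  by_contra! h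
  exact hp (Polynomial.funext fun x => by simp [h x])

lemma eval_det_map {ι : Type*} [Fintype ι] [DecidableEq ι] (M : Matrix ι ι ℂ[X]) (x : ℂ) :
    M.det.eval x = (M.map (eval x)).det := by
  simpa using (RingHom.map_det (evalRingHom x) M)

lemma map_eval_mul {ι κ μ : Type*} [Fintype κ] (M : Matrix ι κ ℂ[X]) (N : Matrix κ μ ℂ[X])
    (x : ℂ) : (M * N).map (eval x) = M.map (eval x) * N.map (eval x) :=
  Matrix.map_mul (f := evalRingHom x)

lemma map_eval_add {ι κ : Type*} (M N : Matrix ι κ ℂ[X]) (x : ℂ) :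
    (M + N).map (eval x) = M.map (eval x) + N.map (eval x) := by
  ext
  simp

/-- A perturbation of rank `r` raises the number of diagonal entries of order less than `J` by
at most `r`. -/
lemma card_order_lt_le {n r : ℕ} {P E Q Q' R R' : Matrix (Fin n) (Fin n) ℂ[X]}
    {d d' : Fin n → ℂ[X]} (hR : IsUnit R) (hR' : IsUnit R') (hP : P = Q * diagonal d * Q')
    (hPE : P + E = R * diagonal d' * R') (hd' : ∀ i, d' i ≠ 0)
    (hE : ∀ x : ℂ, (E.map (eval x)).rank ≤ r) (z : ℂ) (J : ℕ) :
    Fintype.card {i // (d' i).rootMultiplicity z < J}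
      ≤ Fintype.card {i // (d i).rootMultiplicity z < J} + r := by
  obtain ⟨⟨R, Ri, hR1, hR2⟩, rfl⟩ := hR
  obtain ⟨⟨R', Ri', hR1', hR2'⟩, rfl⟩ := hR'
  simp only at hPE
  have hdec : ∀ i, ∃ lo c : ℂ[X], d i = lo + (X - C z) ^ J * c ∧
      (lo ≠ 0 → (d i).rootMultiplicity z < J) := by
    intro i
    by_cases h : (d i).rootMultiplicity z < J
    · exact ⟨d i, 0, by simp, fun _ => h⟩
    · obtain ⟨c, hc⟩ := (pow_dvd_pow (X - C z) (not_lt.mp h)).trans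
        (pow_rootMultiplicity_dvd (d i) z)
      exact ⟨0, c, by simpa using hc, fun h => absurd rfl h⟩
  choose lo c hlo hlo' using hdec
  have hw : ∀ i, ∃ w : ℂ[X], d' i = (X - C z) ^ (d' i).rootMultiplicity z * w ∧ w.eval z ≠ 0 := by
    intro i
    obtain ⟨w, hw, hw'⟩ := exists_eq_pow_rootMultiplicity_mul_and_not_dvd (d' i) (hd' i) z
    exact ⟨w, hw, fun h => hw' (dvd_iff_isRoot.mpr h)⟩
  choose w hw hw' using hw
  set Y := Q * diagonal lo * Q' + E with hY
  set N := Ri * (Q * diagonal c * Q') * Ri' with hN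
  have hdiag : diagonal d = diagonal lo + (X - C z) ^ J • diagonal c := by
    rw [← diagonal_smul, diagonal_add]
    congr 1
    funext i
    exact hlo i
  have hYN : Ri * Y * Ri' = diagonal d' - (X - C z) ^ J • N := by
    have h1 : P + E = Y + (X - C z) ^ J • (Q * diagonal c * Q') := by
      rw [hP, hY, hdiag, Matrix.mul_add, Matrix.add_mul, Matrix.mul_smul, Matrix.smul_mul]
      abel
    have h2 : Ri * (P + E) * Ri' = diagonal d' := by
      rw [hPE]
      simp only [← Matrix.mul_assoc]
      rw [hR2, Matrix.one_mul, Matrix.mul_assoc, hR1', Matrix.mul_one]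
    clear_value Y
    rw [← h2, h1, Matrix.mul_add, Matrix.add_mul, Matrix.mul_smul, Matrix.smul_mul]
    abel
  let T := {i // (d' i).rootMultiplicity z < J}
  let M : Matrix T T ℂ[X] := Ri.submatrix Subtype.val id * Y * Ri'.submatrix id Subtype.val
  let K : Matrix T T ℂ[X] := Matrix.of fun i k => diagonal (fun i : T => w i) i k
    - (X - C z) ^ (J - (d' i).rootMultiplicity z) * N i k
  have hM : M = diagonal (fun i : T => (X - C z) ^ (d' i).rootMultiplicity z) * K := by
    ext1 i k
    have h1 : M i k = (Ri * Y * Ri') i k := rfl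
    have h2 : (X - C z) ^ J
        = (X - C z) ^ (d' i).rootMultiplicity z * (X - C z) ^ (J - (d' i).rootMultiplicity z) := by
      rw [← pow_add, Nat.add_sub_cancel' i.2.le]
    rw [h1, hYN, Matrix.diagonal_mul, Matrix.sub_apply, Matrix.smul_apply, smul_eq_mul, h2]
    simp only [K, Matrix.of_apply]
    rw [mul_sub, mul_assoc]
    congr 1
    by_cases hik : i = k
    · subst hik
      simpa using hw i
    · have : (i : Fin n) ≠ k := fun h => hik (Subtype.ext h)
      simp [hik, this]
  have hK : K.det.eval z ≠ 0 := by
    have : K.map (eval z) = diagonal fun i : T => (w i).eval z := by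
      ext i k
      have hpos : J - (d' i).rootMultiplicity z ≠ 0 := by
        have := i.2
        omega
      by_cases hik : i = k
      · subst hik
        simp [K, hpos]
      · simp [K, hpos, hik]
    rw [eval_det_map, this, det_diagonal]
    exact Finset.prod_ne_zero_iff.mpr fun i _ => hw' i
  have hMdet : M.det ≠ 0 := by
    rw [hM, det_mul, det_diagonal]
    refine mul_ne_zero (Finset.prod_ne_zero_iff.mpr fun i _ =>
      pow_ne_zero _ (X_sub_C_ne_zero z)) fun h => hK ?_
    rw [h, eval_zero]
  obtain ⟨x, hx⟩ := exists_eval_ne_zero hMdet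
  have hrank : (M.map (eval x)).rank = Fintype.card T := by
    refine rank_of_isUnit _ ((isUnit_iff_isUnit_det _).mpr ?_)
    rw [← eval_det_map]
    exact hx.isUnit
  have hle : (M.map (eval x)).rank ≤ (Y.map (eval x)).rank := by
    simp only [M, map_eval_mul]
    exact (rank_mul_le_left _ _).trans (rank_mul_le_right _ _)
  have hle2 : (Y.map (eval x)).rank
      ≤ ((diagonal lo).map (eval x)).rank + (E.map (eval x)).rank := by
    rw [hY, map_eval_add]
    refine (matrix_rank_add_le _ _).trans (Nat.add_le_add_right ?_ _)
    simp only [map_eval_mul]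
    exact (rank_mul_le_left _ _).trans (rank_mul_le_right _ _)
  have hle3 : ((diagonal lo).map (eval x)).rank
      ≤ Fintype.card {i // (d i).rootMultiplicity z < J} := by
    classical
    rw [diagonal_map (eval_zero), rank_diagonal]
    refine Fintype.card_le_of_injective
      (fun i => ⟨i.1, hlo' i.1 fun h => i.2 (by simp [h])⟩) fun i k hik => ?_
    exact Subtype.ext (Subtype.mk.inj hik)
  change Fintype.card T ≤ _
  have := hE x
  omega

lemma map_eval_pencil {n : ℕ} (A B : Matrix (Fin n) (Fin n) ℂ) (x : ℂ) :
    (pencil A B).map (eval x) = A + x • B := by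
  ext
  simp only [pencil, Matrix.map_apply, Matrix.add_apply, Matrix.smul_apply, smul_eq_mul, eval_add,
    eval_mul, eval_X, eval_C]

lemma pencil_add {n : ℕ} (A B A' B' : Matrix (Fin n) (Fin n) ℂ) :
    pencil (A + A') (B + B') = pencil A B + pencil A' B' := by
  ext1 i j
  simp only [pencil, Matrix.add_apply, Matrix.smul_apply, Matrix.map_apply, map_add,
    smul_eq_mul]
  ring

lemma cntGE_add_card {n : ℕ} (e : Fin n → ℕ) (J : ℕ) :
    cntGE (Finset.univ.val.map e) J + Fintype.card {i // e i < J} = n := by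
  have h1 : cntGE (Finset.univ.val.map e) J = (Finset.univ.filter fun i => J ≤ e i).card := by
    rw [cntGE, Multiset.filter_map, Multiset.card_map]
    rfl
  rw [h1, Fintype.card_subtype]
  have := Finset.card_filter_add_card_filter_not (s := (Finset.univ : Finset (Fin n)))
    (fun i => J ≤ e i)
  simpa using this

lemma cntGE_pmFin_le {n r : ℕ} {A B A' B' : Matrix (Fin n) (Fin n) ℂ}
    (h : pencilPoly n A B ≠ 0) (h' : pencilPoly n (A + A') (B + B') ≠ 0)
    (hE : ∀ x : ℂ, (A' + x • B').rank ≤ r) (z : ℂ) (j : ℕ) :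
    cntGE (pmFin n A B z) (j + 1) ≤ cntGE (pmFin n (A + A') (B + B') z) (j + 1) + r := by
  obtain ⟨Q, Q', d, hQ, hQ', hP, hd⟩ := exists_diagonalization (pencil A B) h
  obtain ⟨R, R', d', hR, hR', hP', hd'⟩ :=
    exists_diagonalization (pencil (A + A') (B + B')) h'
  rw [pmFin_eq hQ hQ' hP hd, pmFin_eq hR hR' hP' hd', cntGE_filter_pos, cntGE_filter_pos]
  rw [pencil_add] at hP'
  have h1 := card_order_lt_le hR hR' hP hP' hd'
    (fun x => by rw [map_eval_pencil]; exact hE x) z (j + 1)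
  have h2 := cntGE_add_card (fun i => (d i).rootMultiplicity z) (j + 1)
  have h3 := cntGE_add_card (fun i => (d' i).rootMultiplicity z) (j + 1)
  omega

/-- The entries of the adjugate have minimal order `sumDrop 1` of the partial multiplicities. -/
lemma exists_adjugate_pencil_eq {n : ℕ} (hn : 0 < n) {A B : Matrix (Fin n) (Fin n) ℂ}
    (hA : A.IsSymm) (hB : B.IsSymm) (h : pencilPoly n A B ≠ 0) (z : ℂ) :
    ∃ M : Matrix (Fin n) (Fin n) ℂ[X],
      adjugate (pencil A B) = (X - C z) ^ sumDrop 1 (pmFin n A B z) • M ∧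
      M.map (eval z) ≠ 0 ∧ (M.map (eval z)).IsSymm := by
  obtain ⟨Q, Q', d, hQ, hQ', hP, hd⟩ := exists_diagonalization (pencil A B) h
  rw [pmFin_eq hQ hQ' hP hd, sumDrop_filter_pos]
  have : Nonempty (Fin n) := ⟨⟨0, hn⟩⟩
  set e : Fin n → ℕ := fun i => (d i).rootMultiplicity z with he
  obtain ⟨i₀, -, hi₀⟩ := Finset.exists_max_image Finset.univ e Finset.univ_nonempty
  have hm : sumDrop 1 (Finset.univ.val.map e) = ∑ j ∈ Finset.univ.erase i₀, e j := by
    have h1 : (Finset.univ : Finset (Fin n)).val.map e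
        = e i₀ ::ₘ (Finset.univ.erase i₀).val.map e := by
      conv_lhs => rw [← Finset.insert_erase (Finset.mem_univ i₀),
        Finset.insert_val_of_notMem (Finset.notMem_erase i₀ _), Multiset.map_cons]
    rw [h1, sumDrop_one_cons]
    · rfl
    · intro b hb
      obtain ⟨i, -, rfl⟩ := Multiset.mem_map.mp hb
      exact hi₀ i (Finset.mem_univ i)
  rw [hm]
  set m := ∑ j ∈ Finset.univ.erase i₀, e j with hmdef
  have hprod : ∀ i, ∏ j ∈ Finset.univ.erase i, d j ≠ 0 := fun i =>
    Finset.prod_ne_zero_iff.mpr fun j _ => hd j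
  have hord : ∀ i, (∏ j ∈ Finset.univ.erase i, d j).rootMultiplicity z
      = ∑ j ∈ Finset.univ.erase i, e j := fun i =>
    rootMultiplicity_finset_prod _ (fun j _ => hd j) z
  have hle : ∀ i, m ≤ ∑ j ∈ Finset.univ.erase i, e j := by
    intro i
    have h1 := Finset.add_sum_erase Finset.univ e (Finset.mem_univ i)
    have h2 := Finset.add_sum_erase Finset.univ e (Finset.mem_univ i₀)
    have h3 := hi₀ i (Finset.mem_univ i)
    omega
  have hc : ∀ i, ∃ c : ℂ[X], ∏ j ∈ Finset.univ.erase i, d j = (X - C z) ^ m * c := by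
    intro i
    have := (le_rootMultiplicity_iff (hprod i)).mp ((hle i).trans (hord i).ge)
    exact this
  choose c hc using hc
  have hci : (c i₀).eval z ≠ 0 := by
    intro h0
    obtain ⟨q, hq⟩ := dvd_iff_isRoot.mpr h0
    have h1 : (X - C z) ^ (m + 1) ∣ ∏ j ∈ Finset.univ.erase i₀, d j :=
      ⟨q, by rw [hc, hq]; ring⟩
    have h2 := (le_rootMultiplicity_iff (hprod i₀)).mpr h1
    rw [hord] at h2
    omega
  have hadj : adjugate (pencil A B)
      = (X - C z) ^ m • (adjugate Q' * diagonal c * adjugate Q) := by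
    have h1 : adjugate (diagonal d) = (X - C z) ^ m • diagonal c := by
      rw [adjugate_diagonal, ← diagonal_smul]
      congr 1
      funext i
      exact hc i
    rw [hP, adjugate_mul_distrib, adjugate_mul_distrib, h1, Matrix.smul_mul, Matrix.mul_smul,
      Matrix.mul_assoc]
  refine ⟨_, hadj, fun h0 => ?_, ?_⟩
  · have h1 : Q' * (adjugate Q' * diagonal c * adjugate Q) * Q
        = (Q'.det * Q.det) • diagonal c := by
      simp only [← Matrix.mul_assoc]
      rw [mul_adjugate, Matrix.mul_assoc _ (adjugate Q), adjugate_mul]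
      simp only [Matrix.smul_mul, Matrix.mul_smul, Matrix.one_mul, Matrix.mul_one, smul_smul]
      rw [mul_comm]
    have h2 := congrArg (fun M => M.map (eval z)) h1
    rw [map_eval_mul, map_eval_mul, h0, Matrix.mul_zero, Matrix.zero_mul] at h2
    replace h2 := congrFun (congrFun h2 i₀) i₀
    simp only [Matrix.zero_apply, Matrix.map_apply, Matrix.smul_apply, diagonal_apply_eq,
      smul_eq_mul, eval_mul] at h2
    have hu : ∀ M : Matrix (Fin n) (Fin n) ℂ[X], IsUnit M → M.det.eval z ≠ 0 := fun M hM =>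
      (((isUnit_iff_isUnit_det _).mp hM).map (evalRingHom z)).ne_zero
    exact mul_ne_zero (mul_ne_zero (hu Q' hQ') (hu Q hQ)) hci h2.symm
  · have hsymm : (pencil A B).IsSymm := by
      ext i j
      simp [pencil, hA.apply i j, hB.apply i j]
    have h1 := hsymm.adjugate
    rw [hadj] at h1
    ext i j
    have h2 := h1.apply i j
    simp only [Matrix.smul_apply, smul_eq_mul] at h2
    have h3 := mul_left_cancel₀ (pow_ne_zero m (X_sub_C_ne_zero z)) h2
    simp only [Matrix.transpose_apply, Matrix.map_apply, h3]

lemma det_add_smul_vecMulVec {n : ℕ} {P : Matrix (Fin n) (Fin n) ℂ} (hP : P.det ≠ 0) (c : ℂ)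
    (u : Fin n → ℂ) :
    (P + c • vecMulVec u u).det = P.det + c * (u ⬝ᵥ P.adjugate *ᵥ u) := by
  have h1 : c • vecMulVec u u = replicateCol Unit (c • u) * replicateRow Unit u := by
    rw [← vecMulVec_eq, smul_vecMulVec]
  rw [h1, det_add_replicateCol_mul_replicateRow hP.isUnit, det_unique (n := Unit), Matrix.add_apply,
    Matrix.one_apply_eq, Matrix.mul_assoc]
  have h2 : (replicateRow Unit u * (P⁻¹ * replicateCol Unit (c • u))) default default
      = u ⬝ᵥ P⁻¹ *ᵥ (c • u) := rfl
  have h3 : P.adjugate = P.det • P⁻¹ := by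
    rw [Matrix.inv_def, smul_smul, Ring.mul_inverse_cancel _ hP.isUnit, one_smul]
  rw [h2, h3, mulVec_smul, smul_mulVec, dotProduct_smul, dotProduct_smul]
  simp only [smul_eq_mul]
  ring

lemma eval_pencilPoly {n : ℕ} (A B : Matrix (Fin n) (Fin n) ℂ) (x : ℂ) :
    (pencilPoly n A B).eval x = (A + x • B).det := by
  rw [← map_eval_pencil, ← eval_det_map]
  rfl

/-- The quadratic form `uᵀ adj(A + λB) u`. -/
noncomputable def adjForm {n : ℕ} (A B : Matrix (Fin n) (Fin n) ℂ) (u : Fin n → ℂ) : ℂ[X] :=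
  ∑ i, ∑ j, C (u i) * (adjugate (pencil A B) i j * C (u j))

lemma eval_adjForm {n : ℕ} (A B : Matrix (Fin n) (Fin n) ℂ) (u : Fin n → ℂ) (x : ℂ) :
    (adjForm A B u).eval x = u ⬝ᵥ (A + x • B).adjugate *ᵥ u := by
  have h : (A + x • B).adjugate = (adjugate (pencil A B)).map (eval x) := by
    rw [← map_eval_pencil]
    exact (RingHom.map_adjugate (evalRingHom x) (pencil A B)).symm
  simp [adjForm, h, dotProduct, mulVec, eval_finsetSum, Finset.mul_sum]

lemma pencilPoly_rankOne {n : ℕ} {A B : Matrix (Fin n) (Fin n) ℂ} (h : pencilPoly n A B ≠ 0)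
    (a b : ℂ) (u : Fin n → ℂ) :
    pencilPoly n (A + a • vecMulVec u u) (B + b • vecMulVec u u)
      = pencilPoly n A B + (C a + C b * X) * adjForm A B u := by
  refine mul_left_cancel₀ h (Polynomial.funext fun x => ?_)
  rw [eval_mul, eval_mul]
  by_cases hx : (pencilPoly n A B).eval x = 0
  · rw [hx, zero_mul, zero_mul]
  · congr 1
    rw [eval_pencilPoly] at hx ⊢
    have h1 : A + a • vecMulVec u u + x • (B + b • vecMulVec u u)
        = (A + x • B) + (a + b * x) • vecMulVec u u := by
      rw [smul_add, smul_smul, add_smul, mul_comm]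
      abel
    rw [h1, det_add_smul_vecMulVec hx]
    simp [eval_adjForm, eval_pencilPoly]

lemma natDegree_pencilPoly_le {n : ℕ} (A B : Matrix (Fin n) (Fin n) ℂ) :
    (pencilPoly n A B).natDegree ≤ n := by
  have := natDegree_det_X_add_C_le B A
  rwa [Fintype.card_fin, add_comm] at this

lemma pencilPoly_swap {n : ℕ} (A B : Matrix (Fin n) (Fin n) ℂ) :
    pencilPoly n B A = reflect n (pencilPoly n A B) := by
  refine mul_left_cancel₀ (X_ne_zero (R := ℂ)) (Polynomial.funext fun x => ?_)
  rw [eval_mul, eval_mul, eval_X]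
  by_cases hx : x = 0
  · simp [hx]
  · congr 1
    let := invertibleOfNonzero (inv_ne_zero hx)
    have h1 := eval₂_reflect_mul_pow (RingHom.id ℂ) x⁻¹ n _ (natDegree_pencilPoly_le A B)
    rw [invOf_eq_inv, inv_inv, eval₂_id, eval₂_id, eval_pencilPoly] at h1
    have h2 : B + x • A = x • (A + x⁻¹ • B) := by
      rw [smul_add, smul_smul, mul_inv_cancel₀ hx, one_smul, add_comm]
    rw [eval_pencilPoly, h2, det_smul, ← h1, Fintype.card_fin, mul_comm, mul_assoc, ← mul_pow,
      inv_mul_cancel₀ hx, one_pow, mul_one]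

lemma pencilPoly_swap_ne_zero {n : ℕ} {A B : Matrix (Fin n) (Fin n) ℂ}
    (h : pencilPoly n A B ≠ 0) : pencilPoly n B A ≠ 0 := by
  rwa [pencilPoly_swap, Ne, reflect_eq_zero_iff]

/-- The multiplicity at infinity is the degree defect. -/
lemma rootMultiplicity_swap_add_natDegree {n : ℕ} {A B : Matrix (Fin n) (Fin n) ℂ}
    (h : pencilPoly n A B ≠ 0) :
    (pencilPoly n B A).rootMultiplicity 0 + (pencilPoly n A B).natDegree = n := by
  have hn := natDegree_pencilPoly_le A B
  obtain ⟨k, hk⟩ := Nat.exists_eq_add_of_le hn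
  have h1 : pencilPoly n B A = (pencilPoly n A B).reverse * X ^ k := by
    have := reflect_mul (pencilPoly n A B) 1 (le_refl (pencilPoly n A B).natDegree)
      (G := k) (by simp)
    rw [mul_one, ← hk] at this
    rw [pencilPoly_swap, this, reflect_one]
    rfl
  have h2 : (pencilPoly n A B).reverse ≠ 0 := by rwa [Ne, reverse_eq_zero]
  rw [rootMultiplicity_eq_natTrailingDegree', h1, natTrailingDegree_mul_X_pow h2,
    natTrailingDegree_reverse]
  omega

lemma exists_quadratic_ne_zero {n : ℕ} {M : Matrix (Fin n) (Fin n) ℂ} (hM : M ≠ 0)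
    (hs : M.IsSymm) : ∃ u : Fin n → ℂ, u ⬝ᵥ M *ᵥ u ≠ 0 := by
  by_contra! h
  have hd : ∀ i, M i i = 0 := fun i => by simpa using h (Pi.single i 1)
  refine hM (Matrix.ext fun i j => ?_)
  have h1 := h (Pi.single i 1 + Pi.single j 1)
  simp only [mulVec_add, dotProduct_add, add_dotProduct, single_one_dotProduct,
    mulVec_single_one, Matrix.col_apply, hd, hs.apply i j] at h1
  rw [Matrix.zero_apply]
  linear_combination h1 / 2

/-- For generic `u` and all but one `t`, the perturbation by `t (a + λb) u uᵀ` has the minimal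
possible algebraic multiplicity at `z`. -/
lemma exists_rankOne_local {n : ℕ} (hn : 0 < n) {A B : Matrix (Fin n) (Fin n) ℂ}
    (hA : A.IsSymm) (hB : B.IsSymm) (h : pencilPoly n A B ≠ 0) {z a b : ℂ}
    (hab : a + b * z ≠ 0) :
    ∃ p : MvPolynomial (Fin n) ℂ, p ≠ 0 ∧ ∀ u, MvPolynomial.eval u p ≠ 0 →
      ∃ t₀ : ℂ, ∀ t, t ≠ t₀ →
        (pencilPoly n A B + C t * ((C a + C b * X) * adjForm A B u)).rootMultiplicity z
          = sumDrop 1 (pmFin n A B z) := by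
  obtain ⟨M, hM, hM0, hMs⟩ := exists_adjugate_pencil_eq hn hA hB h z
  obtain ⟨p, hp⟩ : ∃ p : MvPolynomial (Fin n) ℂ, ∀ u : Fin n → ℂ,
      MvPolynomial.eval u p = u ⬝ᵥ M.map (eval z) *ᵥ u :=
    ⟨∑ i, ∑ j, MvPolynomial.X i * (MvPolynomial.C ((M i j).eval z) * MvPolynomial.X j),
      fun u => by simp [dotProduct, mulVec, Finset.mul_sum]⟩
  refine ⟨p, fun h0 => ?_, fun u hu => ?_⟩
  · obtain ⟨u, hu⟩ := exists_quadratic_ne_zero hM0 hMs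
    rw [← hp, h0, map_zero] at hu
    exact hu rfl
  rw [hp] at hu
  set m := sumDrop 1 (pmFin n A B z) with hm
  set k : ℂ[X] := ∑ i, ∑ j, C (u i) * (M i j * C (u j)) with hk
  have hkz : k.eval z ≠ 0 := by
    simpa [k, eval_finsetSum, dotProduct, mulVec, Finset.mul_sum] using hu
  have hform : adjForm A B u = (X - C z) ^ m * k := by
    simp only [adjForm, hM, k, Finset.mul_sum, Matrix.smul_apply, smul_eq_mul]
    refine Finset.sum_congr rfl fun i _ => Finset.sum_congr rfl fun j _ => by ring
  have hle : m ≤ (pencilPoly n A B).rootMultiplicity z := by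
    rw [← sum_pmFin h]
    exact sumDrop_le_sum fun j => Nat.le_add_right _ _
  obtain ⟨e, he⟩ := (le_rootMultiplicity_iff h).mp hle
  refine ⟨-(e.eval z) / ((a + b * z) * k.eval z), fun t ht => ?_⟩
  have h1 : pencilPoly n A B + C t * ((C a + C b * X) * adjForm A B u)
      = (e + C t * ((C a + C b * X) * k)) * (X - C z) ^ m := by
    rw [he, hform]
    ring
  have h2 : (e + C t * ((C a + C b * X) * k)).eval z ≠ 0 := by
    intro h0
    refine ht ?_
    rw [eq_div_iff (mul_ne_zero hab hkz)]
    simp only [eval_add, eval_mul, eval_C, eval_X] at h0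
    linear_combination h0
  have h3 : e + C t * ((C a + C b * X) * k) ≠ 0 := fun h0 => h2 (by rw [h0, eval_zero])
  rw [h1, rootMultiplicity_mul_X_sub_C_pow h3, rootMultiplicity_eq_zero h2, zero_add]

lemma exists_finset_simple {D c : ℂ[X]} {z₀ : ℂ} (hD : D.eval z₀ ≠ 0) (hc : c.eval z₀ = 0) :
    ∃ T : Finset ℂ, ∀ t ∉ T, ∀ z, D.eval z ≠ 0 → (D + C t * c).rootMultiplicity z ≤ 1 := by
  classical
  by_cases hc0 : c = 0
  · refine ⟨∅, fun t _ z hz => ?_⟩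
    rw [hc0, mul_zero, add_zero, rootMultiplicity_eq_zero hz]
    exact zero_le_one
  have hW : D * derivative c - derivative D * c ≠ 0 := by
    intro h0
    obtain ⟨w, hw, hw'⟩ := exists_eq_pow_rootMultiplicity_mul_and_not_dvd c hc0 z₀
    have hm : 0 < c.rootMultiplicity z₀ := (rootMultiplicity_pos hc0).mpr hc
    obtain ⟨m, hm⟩ := Nat.exists_eq_add_of_lt hm
    rw [zero_add] at hm
    rw [hm] at hw
    have hX : (X - C z₀) ^ m ≠ 0 := pow_ne_zero _ (X_sub_C_ne_zero z₀)
    have h1 : (X - C z₀) ^ m * (C ((m : ℂ) + 1) * D * w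
        + (X - C z₀) * (D * derivative w - derivative D * w)) = 0 := by
      rw [← h0, hw, derivative_mul, derivative_X_sub_C_pow]
      simp only [Nat.add_sub_cancel, map_add, map_natCast, map_one, Nat.cast_add, Nat.cast_one]
      ring
    have h2 := congrArg (eval z₀) ((mul_eq_zero.mp h1).resolve_left hX)
    simp only [eval_add, eval_mul, eval_C, eval_sub, eval_X, sub_self, zero_mul, add_zero,
      eval_zero] at h2
    have hwz : w.eval z₀ ≠ 0 := fun h => hw' (dvd_iff_isRoot.mpr h)
    exact mul_ne_zero (mul_ne_zero (Nat.cast_add_one_ne_zero m) hD) hwz h2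
  refine ⟨(D * derivative c - derivative D * c).roots.toFinset.image
    fun z => -(D.eval z) / c.eval z, fun t ht z hz => ?_⟩
  by_contra! h1
  have hf : D + C t * c ≠ 0 := by
    intro h0
    rw [h0, rootMultiplicity_zero] at h1
    omega
  obtain ⟨h2, h3⟩ := (one_lt_rootMultiplicity_iff_isRoot hf).mp h1
  simp only [IsRoot, eval_add, eval_mul, eval_C, derivative_add, derivative_mul, derivative_C,
    zero_mul, zero_add] at h2 h3
  have hcz : c.eval z ≠ 0 := by
    intro h0
    rw [h0, mul_zero, add_zero] at h2
    exact hz h2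
  refine ht (Finset.mem_image.mpr ⟨z, ?_, ?_⟩)
  · rw [Multiset.mem_toFinset, mem_roots hW]
    simp only [IsRoot, eval_sub, eval_mul]
    linear_combination (derivative c).eval z * h2 - c.eval z * h3
  · rw [div_eq_iff hcz]
    linear_combination -h2

lemma rank_finset_sum_le {ι : Type*} {n : ℕ} (s : Finset ι) (M : ι → Matrix (Fin n) (Fin n) ℂ)
    {k : ℕ} (h : ∀ i ∈ s, (M i).rank ≤ k) : (∑ i ∈ s, M i).rank ≤ s.card * k := by
  classical
  induction s using Finset.induction_on with
  | empty => simp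
  | insert a s ha ih =>
    rw [Finset.sum_insert ha, Finset.card_insert_of_notMem ha]
    have h1 := matrix_rank_add_le (M a) (∑ i ∈ s, M i)
    have h2 := h a (Finset.mem_insert_self a s)
    have h3 := ih fun i hi => h i (Finset.mem_insert_of_mem hi)
    linarith

lemma rank_smul_le {n : ℕ} (c : ℂ) (M : Matrix (Fin n) (Fin n) ℂ) : (c • M).rank ≤ M.rank := by
  have : c • M = M * (c • (1 : Matrix (Fin n) (Fin n) ℂ)) := by simp
  rw [this]
  exact rank_mul_le_left _ _

lemma rank_sum_vecMulVec_le {n r : ℕ} (w : Fin r → Fin n → ℂ) :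
    (∑ i, vecMulVec (w i) (w i)).rank ≤ r := by
  have := rank_finset_sum_le Finset.univ (fun i => vecMulVec (w i) (w i)) (k := 1)
    fun i _ => rank_vecMulVec_le _ _
  simpa using this

lemma exists_mvPolynomial_eval_ne_zero {σ : Type*} {p : MvPolynomial σ ℂ} (hp : p ≠ 0) :
    ∃ u, MvPolynomial.eval u p ≠ 0 := by
  by_contra! h
  exact hp (MvPolynomial.funext fun u => by rw [h u, map_zero])

lemma sumDrop_zero_left (s : Multiset ℕ) : sumDrop 0 s = s.sum := by
  rw [sumDrop]
  simpa using sum_cntGE s s.sum fun a ha => Multiset.le_sum_of_mem ha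

/-- A good rank-one step: the perturbation `(λ - z₀) u uᵀ` removes the largest partial multiplicity
at every eigenvalue and creates only simple new eigenvalues. -/
lemma exists_rankOne_step {n : ℕ} {A B : Matrix (Fin n) (Fin n) ℂ} (hA : A.IsSymm)
    (hB : B.IsSymm) {z₀ : ℂ} (h0 : (pencilPoly n A B).eval z₀ ≠ 0) (F : Finset ℂ) (hF : z₀ ∉ F) :
    ∃ u : Fin n → ℂ,
      (∀ z, z ∈ F ∨ (pencilPoly n A B).eval z = 0 →
        (pencilPoly n (A + (-z₀) • vecMulVec u u) (B + vecMulVec u u)).rootMultiplicity z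
          = sumDrop 1 (pmFin n A B z)) ∧
      (pencilPoly n (B + vecMulVec u u) (A + (-z₀) • vecMulVec u u)).rootMultiplicity 0
          = sumDrop 1 (pmFin n B A 0) ∧
      ∀ z, (pencilPoly n A B).eval z ≠ 0 →
        (pencilPoly n (A + (-z₀) • vecMulVec u u) (B + vecMulVec u u)).rootMultiplicity z ≤ 1 := by
  classical
  rcases Nat.eq_zero_or_pos n with rfl | hn
  · have h1 : ∀ A B, pencilPoly 0 A B = 1 := fun A B => det_isEmpty
    have h2 : ∀ (z : ℂ) (A B), pmFin 0 A B z = 0 := fun z A B => by simp [pmFin]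
    have h3 : ∀ z : ℂ, (1 : ℂ[X]).rootMultiplicity z = 0 := fun z =>
      rootMultiplicity_eq_zero (by simp [IsRoot])
    exact ⟨0, fun z _ => by simp [h1, h2, h3, sumDrop], by simp [h1, h2, h3, sumDrop],
      fun z _ => by simp [h1, h3]⟩
  have hreg : pencilPoly n A B ≠ 0 := fun h => h0 (by rw [h, eval_zero])
  have hreg' := pencilPoly_swap_ne_zero hreg
  let S := F ∪ (pencilPoly n A B).roots.toFinset
  have hS : ∀ z, z ∈ S ↔ z ∈ F ∨ (pencilPoly n A B).eval z = 0 := fun z => by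
    simp [S, hreg]
  have hz : ∀ z : S, (-z₀) + 1 * (z : ℂ) ≠ 0 := by
    rintro ⟨z, hz⟩ h1
    have : z = z₀ := by linear_combination h1
    subst this
    rcases (hS z).mp hz with h | h
    · exact hF h
    · exact h0 h
  choose p hp hp' using fun z : S => exists_rankOne_local hn hA hB hreg (hz z)
  obtain ⟨q, hq, hq'⟩ := exists_rankOne_local hn hB hA hreg' (z := 0) (a := 1) (b := -z₀)
    (by simp)
  obtain ⟨u, hu⟩ := exists_mvPolynomial_eval_ne_zero
    (mul_ne_zero (Finset.prod_ne_zero_iff.mpr fun z (_ : z ∈ Finset.univ) => hp z) hq)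
  rw [map_mul, map_prod] at hu
  obtain ⟨hu1, hu2⟩ := mul_ne_zero_iff.mp hu
  choose t₁ ht₁ using fun z : S => hp' z u (Finset.prod_ne_zero_iff.mp hu1 z (Finset.mem_univ z))
  obtain ⟨t₂, ht₂⟩ := hq' u hu2
  obtain ⟨T, hT⟩ := exists_finset_simple (c := (C (-z₀) + C 1 * X) * adjForm A B u) h0
    (by simp)
  obtain ⟨t, ht⟩ := Infinite.exists_notMem_finset (Finset.univ.image t₁ ∪ {t₂} ∪ T)
  simp only [Finset.mem_union, Finset.mem_image, Finset.mem_univ, true_and, not_or, not_exists,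
    Finset.mem_singleton] at ht
  obtain ⟨⟨hta, htb⟩, htc⟩ := ht
  obtain ⟨w, hw⟩ := IsAlgClosed.exists_eq_mul_self t
  have hwu : vecMulVec (w • u) (w • u) = t • vecMulVec u u := by
    rw [smul_vecMulVec, vecMulVec_smul, smul_smul, hw]
  have e1 : pencilPoly n (A + (-z₀) • vecMulVec (w • u) (w • u)) (B + vecMulVec (w • u) (w • u))
      = pencilPoly n A B + C t * ((C (-z₀) + C 1 * X) * adjForm A B u) := by
    rw [hwu, smul_smul, pencilPoly_rankOne hreg]
    simp only [map_mul, map_one]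
    ring
  have e2 : pencilPoly n (B + vecMulVec (w • u) (w • u)) (A + (-z₀) • vecMulVec (w • u) (w • u))
      = pencilPoly n B A + C t * ((C 1 + C (-z₀) * X) * adjForm B A u) := by
    rw [hwu, smul_smul, pencilPoly_rankOne hreg']
    simp only [map_mul, map_one]
    ring
  refine ⟨w • u, fun z hz => ?_, ?_, fun z hz => ?_⟩
  · rw [e1]
    exact ht₁ ⟨z, (hS z).mpr hz⟩ t fun h => hta _ h.symm
  · rw [e2]
    exact ht₂ t htb
  · rw [e1]
    exact hT t htc z hz

lemma exists_rank_perturbation {n : ℕ} {A B : Matrix (Fin n) (Fin n) ℂ} (hA : A.IsSymm)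
    (hB : B.IsSymm) {z₀ : ℂ} (h0 : (pencilPoly n A B).eval z₀ ≠ 0) (r : ℕ) :
    ∃ w : Fin r → Fin n → ℂ, ∀ U, U = ∑ i, vecMulVec (w i) (w i) →
      pencilPoly n (A + (-z₀) • U) (B + U) ≠ 0 ∧
      (∀ z, (pencilPoly n A B).eval z = 0 →
        (pencilPoly n (A + (-z₀) • U) (B + U)).rootMultiplicity z
          = sumDrop r (pmFin n A B z)) ∧
      (pencilPoly n (B + U) (A + (-z₀) • U)).rootMultiplicity 0 = sumDrop r (pmFin n B A 0) ∧
      ∀ z, (pencilPoly n A B).eval z ≠ 0 →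
        (pencilPoly n (A + (-z₀) • U) (B + U)).rootMultiplicity z ≤ 1 := by
  classical
  have hreg : pencilPoly n A B ≠ 0 := fun h => h0 (by rw [h, eval_zero])
  have hreg' := pencilPoly_swap_ne_zero hreg
  have hz₀ : ∀ U, (pencilPoly n (A + (-z₀) • U) (B + U)).eval z₀ ≠ 0 := by
    intro U
    rw [eval_pencilPoly] at h0 ⊢
    convert h0 using 2
    rw [smul_add, neg_smul]
    abel
  have hne : ∀ U, pencilPoly n (A + (-z₀) • U) (B + U) ≠ 0 := fun U h =>
    hz₀ U (by rw [h, eval_zero])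
  induction r with
  | zero =>
    refine ⟨Fin.elim0, ?_⟩
    rintro U rfl
    simp only [Finset.univ_eq_empty, Finset.sum_empty, smul_zero, add_zero, sumDrop_zero_left]
    refine ⟨hreg, fun z _ => (sum_pmFin hreg z).symm, (sum_pmFin hreg' 0).symm, fun z hz => ?_⟩
    rw [rootMultiplicity_eq_zero hz]
    exact zero_le_one
  | succ r ih =>
    obtain ⟨w, hw⟩ := ih
    obtain ⟨U, hU⟩ : ∃ U, U = ∑ i, vecMulVec (w i) (w i) := ⟨_, rfl⟩
    obtain ⟨-, h1, h2, h3⟩ := hw U hU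
    have hUs : U.IsSymm := by
      rw [hU]
      ext i j
      simp only [Matrix.transpose_apply, Matrix.sum_apply, vecMulVec_apply, mul_comm]
    have hrank : ∀ c : ℂ, (c • U).rank ≤ r := fun c =>
      (rank_smul_le c U).trans (hU ▸ rank_sum_vecMulVec_le w)
    obtain ⟨u, hu1, hu2, hu3⟩ := exists_rankOne_step (hA.add (hUs.smul (-z₀))) (hB.add hUs)
      (hz₀ U) (pencilPoly n A B).roots.toFinset (by simp [hreg, h0])
    refine ⟨Fin.snoc w u, ?_⟩
    rintro V hV
    have hVU : V = U + vecMulVec u u := by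
      rw [hV, Fin.sum_univ_castSucc, hU]
      simp
    have hA' : A + (-z₀) • V = A + (-z₀) • U + (-z₀) • vecMulVec u u := by
      rw [hVU, smul_add, add_assoc]
    have hB' : B + V = B + U + vecMulVec u u := by
      rw [hVU, add_assoc]
    refine ⟨hne V, fun z hz => ?_, ?_, fun z hz => ?_⟩
    · rw [hA', hB', hu1 z (Or.inl (by simpa [hreg] using hz))]
      refine sumDrop_add (cntGE_eq_of_sum_eq (cntGE_pmFin_le hreg (hne U) (fun x => ?_) z) ?_) 1
      · rw [← add_smul]
        exact hrank _
      · rw [sum_pmFin (hne U), h1 z hz]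
    · rw [hA', hB', hu2]
      refine sumDrop_add (cntGE_eq_of_sum_eq
        (cntGE_pmFin_le hreg' (pencilPoly_swap_ne_zero (hne U)) (fun x => ?_) 0) ?_) 1
      · rw [smul_smul]
        nth_rewrite 1 [← one_smul ℂ U]
        rw [← add_smul]
        exact hrank _
      · rw [sum_pmFin (pencilPoly_swap_ne_zero (hne U)), h2]
    · rw [hA', hB']
      by_cases h4 : (pencilPoly n (A + (-z₀) • U) (B + U)).eval z = 0
      · rw [hu1 z (Or.inr h4)]
        refine le_trans ?_ (h3 z hz)
        rw [← sum_pmFin (hne U)]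
        exact sumDrop_le_sum fun j => Nat.le_add_right _ _
      · exact hu3 z h4

lemma rank_PhiSym_le {n l s : ℕ} (x : IdxS l s n → ℂ) (c d : ℂ) :
    (c • PhiSymA n l s x + d • PhiSymB n l s x).rank ≤ l + (s + s) := by
  have h : c • PhiSymA n l s x + d • PhiSymB n l s x
      = (∑ i : Fin l, (c * x (.inl (.inl i)) + d * x (.inl (.inr i))) •
          vecMulVec (fun k => x (.inr (.inl i, k))) (fun k => x (.inr (.inl i, k))))
        + ∑ j : Fin s, (vecMulVec (fun k => x (.inr (.inr (.inl j), k)))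
            (fun k => c * x (.inr (.inr (.inr (.inl j)), k))
              + d * x (.inr (.inr (.inr (.inr j)), k)))
          + vecMulVec (fun k => c * x (.inr (.inr (.inr (.inl j)), k))
              + d * x (.inr (.inr (.inr (.inr j)), k)))
            (fun k => x (.inr (.inr (.inl j), k)))) := by
    ext a b
    simp only [PhiSymA, PhiSymB, Matrix.add_apply, Matrix.smul_apply, Matrix.sum_apply,
      vecMulVec_apply, smul_eq_mul, mul_add, Finset.mul_sum, Finset.sum_add_distrib, add_mul]
    simp only [mul_assoc, mul_left_comm _ c, mul_left_comm _ d]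
    ring
  rw [h]
  refine (matrix_rank_add_le _ _).trans (Nat.add_le_add ?_ ?_)
  · refine (rank_finset_sum_le _ _ (k := 1) fun i _ =>
      (rank_smul_le _ _).trans (rank_vecMulVec_le _ _)).trans ?_
    simp
  · refine (rank_finset_sum_le _ _ (k := 2) fun i _ => (matrix_rank_add_le _ _).trans
      (Nat.add_le_add (rank_vecMulVec_le _ _) (rank_vecMulVec_le _ _))).trans ?_
    simp [mul_two]

lemma exists_PhiSym_eq {n l s : ℕ} (z₀ : ℂ) (w : Fin (l + (s + s)) → Fin n → ℂ) :
    ∃ x : IdxS l s n → ℂ,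
      PhiSymA n l s x = (-z₀) • ∑ i, vecMulVec (w i) (w i) ∧
      PhiSymB n l s x = ∑ i, vecMulVec (w i) (w i) := by
  let p : Fin s → Fin n → ℂ := fun j => w (Fin.natAdd l (Fin.castAdd s j))
  let q : Fin s → Fin n → ℂ := fun j => w (Fin.natAdd l (Fin.natAdd s j))
  let y : Fin s → Fin n → ℂ := fun j k => (p j k - Complex.I * q j k) / 2
  let x : IdxS l s n → ℂ := Sum.elim (Sum.elim (fun _ => -z₀) fun _ => 1) fun ik =>
    Sum.elim (fun i => w (Fin.castAdd (s + s) i) ik.2) (Sum.elim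
      (fun j => p j ik.2 + Complex.I * q j ik.2)
      (Sum.elim (fun j => -z₀ * y j ik.2) fun j => y j ik.2)) ik.1
  refine ⟨x, ?_, ?_⟩
  · ext a b
    simp only [PhiSymA, Matrix.add_apply, Matrix.smul_apply, Matrix.sum_apply,
      vecMulVec_apply, smul_eq_mul, x, Sum.elim_inl, Sum.elim_inr, Fin.sum_univ_add,
      mul_add (-z₀), Finset.mul_sum]
    rw [← Finset.sum_add_distrib]
    congr 1
    refine Finset.sum_congr rfl fun j _ => ?_
    simp only [y, p, q]
    ring_nf
    simp only [Complex.I_sq]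
    ring
  · ext a b
    simp only [PhiSymB, Matrix.add_apply, Matrix.smul_apply, Matrix.sum_apply,
      vecMulVec_apply, smul_eq_mul, x, Sum.elim_inl, Sum.elim_inr, Fin.sum_univ_add, one_mul]
    rw [← Finset.sum_add_distrib]
    congr 1
    refine Finset.sum_congr rfl fun j _ => ?_
    simp only [y, p, q]
    ring_nf
    simp only [Complex.I_sq]
    ring

lemma forall_rootMultiplicity_le_one_iff {g : ℂ[X]} (hg : g ≠ 0) :
    (∀ z, g.rootMultiplicity z ≤ 1) ↔
      g.natDegree = 0 ∨ resultant g (derivative g) g.natDegree (g.natDegree - 1) ≠ 0 := by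
  constructor
  · intro h
    right
    have hsep : g.Separable := (nodup_roots_iff_of_splits hg (IsAlgClosed.splits g)).mp
      (Multiset.nodup_iff_count_le_one.mpr fun z => by rw [count_roots]; exact h z)
    have := resultant_ne_zero g (derivative g) hsep
    rwa [natDegree_derivative] at this
  · rintro (h | h) z
    · rw [eq_C_of_natDegree_eq_zero h, rootMultiplicity_C]
      exact zero_le_one
    · by_contra! hz
      obtain ⟨h1, h2⟩ := (one_lt_rootMultiplicity_iff_isRoot hg).mp hz
      by_cases hd : g.natDegree = 0
      · rw [eq_C_of_natDegree_eq_zero hd, rootMultiplicity_C] at hz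
        omega
      obtain ⟨p, q, -, -, hpq⟩ := exists_mul_add_mul_eq_C_resultant
        (m := g.natDegree) (n := g.natDegree - 1) g (derivative g) le_rfl (natDegree_derivative_le g) (Or.inl hd)
      have h3 := congrArg (eval z) hpq
      rw [eval_add, eval_mul, eval_mul, h1.eq_zero, h2.eq_zero, zero_mul, zero_mul, add_zero,
        eval_C] at h3
      exact h h3.symm

/-- In a polynomial family of polynomials divisible by `q` and of degree at most `N`, one member
with degree `N`, no further roots in `Z` and simple roots elsewhere makes these properties
generic. -/
lemma exists_generic_roots {σ : Type*} (F : (MvPolynomial σ ℂ)[X]) {q : ℂ[X]} (hq : q.Monic)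
    (Z : Finset ℂ) (hqZ : ∀ z ∉ Z, q.eval z ≠ 0) {N : ℕ}
    (hdvd : ∀ x, q ∣ F.map (MvPolynomial.eval x))
    (hdeg : ∀ x, (F.map (MvPolynomial.eval x)).natDegree ≤ N) {P : ℂ[X] → Prop}
    (hP : ∀ f, P f ↔ f ≠ 0 ∧ f.natDegree = N ∧
      (∀ z ∈ Z, f.rootMultiplicity z = q.rootMultiplicity z) ∧
      ∀ z ∉ Z, f.rootMultiplicity z ≤ 1)
    {x₀ : σ → ℂ} (hx₀ : P (F.map (MvPolynomial.eval x₀))) :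
    ∃ p : MvPolynomial σ ℂ, p ≠ 0 ∧ ∀ x, MvPolynomial.eval x p ≠ 0 →
      P (F.map (MvPolynomial.eval x)) := by
  set D := N - q.natDegree with hD
  have hqmap : (q.map (MvPolynomial.C (σ := σ))).Monic := hq.map _
  set G := F /ₘ q.map MvPolynomial.C with hG
  have hGx : ∀ x, G.map (MvPolynomial.eval x) = F.map (MvPolynomial.eval x) /ₘ q := by
    intro x
    have h1 : (MvPolynomial.eval x).comp MvPolynomial.C = RingHom.id ℂ := by
      ext
      simp
    rw [hG, map_divByMonic _ hqmap, Polynomial.map_map, h1, Polynomial.map_id]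
  have hFx : ∀ x, F.map (MvPolynomial.eval x) = q * G.map (MvPolynomial.eval x) := by
    intro x
    have := modByMonic_add_div (F.map (MvPolynomial.eval x)) q
    rw [(modByMonic_eq_zero_iff_dvd hq).mpr (hdvd x), zero_add] at this
    rw [hGx, this]
  have hGdeg : ∀ x, (G.map (MvPolynomial.eval x)).natDegree ≤ D := by
    intro x
    rw [hGx, natDegree_divByMonic _ hq]
    exact Nat.sub_le_sub_right (hdeg x) _
  have hqN : q.natDegree ≤ N := by
    obtain ⟨h1, h2, -⟩ := (hP _).mp hx₀
    rw [← h2]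
    exact natDegree_le_of_dvd (hdvd x₀) h1
  obtain ⟨R, hR⟩ : ∃ R : MvPolynomial σ ℂ, ∀ x, MvPolynomial.eval x R ≠ 0 ↔
      D = 0 ∨ resultant (G.map (MvPolynomial.eval x)) (derivative (G.map (MvPolynomial.eval x)))
        D (D - 1) ≠ 0 := by
    by_cases h : D = 0
    · exact ⟨1, fun x => by simp [h]⟩
    · refine ⟨resultant G (derivative G) D (D - 1), fun x => ?_⟩
      rw [derivative_map, resultant_map_map]
      simp [h]
  have key : ∀ x, P (F.map (MvPolynomial.eval x)) ↔
      MvPolynomial.eval x (G.coeff D * (∏ z ∈ Z, G.eval (MvPolynomial.C z)) * R) ≠ 0 := by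
    intro x
    have hev : ∀ z, MvPolynomial.eval x (G.eval (MvPolynomial.C z))
        = (G.map (MvPolynomial.eval x)).eval z := by
      intro z
      have := Polynomial.hom_eval₂ G (RingHom.id _) (MvPolynomial.eval x) (MvPolynomial.C z)
      rw [eval₂_id, RingHom.comp_id, MvPolynomial.eval_C] at this
      rw [this, eval_map]
    rw [map_mul, map_mul, map_prod, mul_ne_zero_iff, mul_ne_zero_iff, Finset.prod_ne_zero_iff,
      hR, ← coeff_map, hP]
    simp only [hev]
    have hGd := hGdeg x
    rw [hFx x]
    generalize G.map (MvPolynomial.eval x) = g at *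
    by_cases hg : g = 0
    · simp [hg]
    have hmul : ∀ z, (q * g).rootMultiplicity z = q.rootMultiplicity z + g.rootMultiplicity z :=
      fun z => rootMultiplicity_mul (mul_ne_zero hq.ne_zero hg)
    have hdegiff : (q * g).natDegree = N ↔ g.natDegree = D := by
      rw [natDegree_mul hq.ne_zero hg]
      omega
    have hdegiff' : g.natDegree = D ↔ g.coeff D ≠ 0 := by
      constructor
      · rintro h
        rw [← h]
        exact leadingCoeff_ne_zero.mpr hg
      · exact natDegree_eq_of_le_of_coeff_ne_zero hGd
    have hroot : ∀ z, g.rootMultiplicity z = 0 ↔ g.eval z ≠ 0 := fun z => by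
      rw [rootMultiplicity_eq_zero_iff]
      simp [hg, IsRoot]
    constructor
    · rintro ⟨-, h1, h2, h3⟩
      rw [hdegiff] at h1
      have h4 : ∀ z ∈ Z, g.eval z ≠ 0 := fun z hz => (hroot z).mp (by
        have := h2 z hz
        rw [hmul] at this
        omega)
      refine ⟨⟨hdegiff'.mp h1, h4⟩, ?_⟩
      rw [← h1]
      refine (forall_rootMultiplicity_le_one_iff hg).mp fun z => ?_
      by_cases hz : z ∈ Z
      · rw [(hroot z).mpr (h4 z hz)]
        exact zero_le_one
      · have := h3 z hz
        rw [hmul] at this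
        omega
    · rintro ⟨⟨h1, h2⟩, h3⟩
      have h4 := hdegiff'.mpr h1
      rw [← h4] at h3
      have h5 := (forall_rootMultiplicity_le_one_iff hg).mpr h3
      refine ⟨mul_ne_zero hq.ne_zero hg, hdegiff.mpr h4, fun z hz => ?_, fun z hz => ?_⟩
      · rw [hmul, (hroot z).mpr (h2 z hz), add_zero]
      · rw [hmul, rootMultiplicity_eq_zero (hqZ z hz), zero_add]
        exact h5 z
  exact ⟨_, fun h => (key x₀).mp hx₀ (by rw [h, map_zero]), fun x hx => (key x).mpr hx⟩

lemma exists_universal_pencilPoly {n l s : ℕ} (A B : Matrix (Fin n) (Fin n) ℂ) :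
    ∃ F : (MvPolynomial (IdxS l s n) ℂ)[X], ∀ x, F.map (MvPolynomial.eval x)
      = pencilPoly n (A + PhiSymA n l s x) (B + PhiSymB n l s x) := by
  let Y : IdxS l s n → MvPolynomial (IdxS l s n) ℂ := MvPolynomial.X
  let A' : Matrix (Fin n) (Fin n) (MvPolynomial (IdxS l s n) ℂ) := Matrix.of fun a b =>
    MvPolynomial.C (A a b)
      + ((∑ i, Y (.inl (.inl i)) * (Y (.inr (.inl i, a)) * Y (.inr (.inl i, b))))
        + ∑ j, (Y (.inr (.inr (.inl j), a)) * Y (.inr (.inr (.inr (.inl j)), b))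
          + Y (.inr (.inr (.inr (.inl j)), a)) * Y (.inr (.inr (.inl j), b))))
  let B' : Matrix (Fin n) (Fin n) (MvPolynomial (IdxS l s n) ℂ) := Matrix.of fun a b =>
    MvPolynomial.C (B a b)
      + ((∑ i, Y (.inl (.inr i)) * (Y (.inr (.inl i, a)) * Y (.inr (.inl i, b))))
        + ∑ j, (Y (.inr (.inr (.inl j), a)) * Y (.inr (.inr (.inr (.inr j)), b))
          + Y (.inr (.inr (.inr (.inr j)), a)) * Y (.inr (.inr (.inl j), b))))
  refine ⟨(A'.map C + (X : (MvPolynomial (IdxS l s n) ℂ)[X]) • B'.map C).det, fun x => ?_⟩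
  have hA' : ∀ a b, MvPolynomial.eval x (A' a b) = (A + PhiSymA n l s x) a b := fun a b => by
    simp [A', Y, PhiSymA, Matrix.sum_apply, vecMulVec_apply]
  have hB' : ∀ a b, MvPolynomial.eval x (B' a b) = (B + PhiSymB n l s x) a b := fun a b => by
    simp [B', Y, PhiSymB, Matrix.sum_apply, vecMulVec_apply]
  have h := RingHom.map_det (mapRingHom (MvPolynomial.eval x))
    (A'.map C + (X : (MvPolynomial (IdxS l s n) ℂ)[X]) • B'.map C)
  rw [coe_mapRingHom] at h
  rw [h, pencilPoly]
  congr 1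
  ext1 a b
  simp only [RingHom.mapMatrix_apply, Matrix.map_apply, Matrix.add_apply, Matrix.smul_apply,
    smul_eq_mul, coe_mapRingHom, Polynomial.map_add, Polynomial.map_mul, map_X, map_C, hA', hB']

lemma pos_of_mem_pmAt {n : ℕ} {A B : Matrix (Fin n) (Fin n) ℂ} {μ : Option ℂ} {a : ℕ}
    (ha : a ∈ pmAt n A B μ) : 0 < a := by
  have key : ∀ {A B : Matrix (Fin n) (Fin n) ℂ} {z : ℂ}, a ∈ pmFin n A B z → 0 < a := fun h =>
    (Multiset.mem_filter.mp h).2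
  cases μ <;> exact key ha

lemma sum_pmAt {n : ℕ} {A B : Matrix (Fin n) (Fin n) ℂ} (h : pencilPoly n A B ≠ 0)
    (μ : Option ℂ) : (pmAt n A B μ).sum = algMultAt n A B μ := by
  cases μ with
  | none => exact sum_pmFin (pencilPoly_swap_ne_zero h) 0
  | some z => exact sum_pmFin h z

lemma isEigenvalue_iff {n : ℕ} {A B : Matrix (Fin n) (Fin n) ℂ} (h : pencilPoly n A B ≠ 0)
    (μ : Option ℂ) : IsEigenvalue n A B μ ↔ algMultAt n A B μ ≠ 0 := by
  rw [IsEigenvalue, ← sum_pmAt h, not_iff_not, Multiset.sum_eq_zero_iff]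
  refine ⟨fun h0 a ha => ?_, fun h0 => Multiset.eq_zero_of_forall_notMem fun a ha => ?_⟩
  · simp [h0] at ha
  · exact (pos_of_mem_pmAt ha).ne' (h0 a ha)

lemma cntGE_pmAt_le {n l s : ℕ} {A B : Matrix (Fin n) (Fin n) ℂ} {x : IdxS l s n → ℂ}
    (h : pencilPoly n A B ≠ 0)
    (h' : pencilPoly n (A + PhiSymA n l s x) (B + PhiSymB n l s x) ≠ 0) (μ : Option ℂ) (j : ℕ) :
    cntGE (pmAt n A B μ) (j + 1)
      ≤ cntGE (pmAt n (A + PhiSymA n l s x) (B + PhiSymB n l s x) μ) (j + 1) + (l + (s + s)) := by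
  cases μ with
  | none =>
    refine cntGE_pmFin_le (pencilPoly_swap_ne_zero h) (pencilPoly_swap_ne_zero h') (fun y => ?_)
      0 j
    rw [add_comm]
    simpa using rank_PhiSym_le x y 1
  | some z =>
    refine cntGE_pmFin_le h h' (fun y => ?_) z j
    simpa using rank_PhiSym_le x 1 y

lemma sumDrop_le_algMultAt {n l s : ℕ} {A B : Matrix (Fin n) (Fin n) ℂ} {x : IdxS l s n → ℂ}
    (h : pencilPoly n A B ≠ 0)
    (h' : pencilPoly n (A + PhiSymA n l s x) (B + PhiSymB n l s x) ≠ 0) (μ : Option ℂ) :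
    sumDrop (l + (s + s)) (pmAt n A B μ)
      ≤ algMultAt n (A + PhiSymA n l s x) (B + PhiSymB n l s x) μ := by
  rw [← sum_pmAt h']
  exact sumDrop_le_sum (cntGE_pmAt_le h h' μ)

lemma rootMultiplicity_prod_X_sub_C_pow {Z : Finset ℂ} (m : ℂ → ℕ) {z : ℂ} (hz : z ∈ Z) :
    (∏ y ∈ Z, (X - C y) ^ m y).rootMultiplicity z = m z := by
  have h : (∏ y ∈ Z.erase z, (X - C y) ^ m y).eval z ≠ 0 := by
    rw [eval_prod, Finset.prod_ne_zero_iff]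
    intro y hy
    rw [eval_pow, eval_sub, eval_X, eval_C]
    exact pow_ne_zero _ (sub_ne_zero.mpr (Finset.ne_of_mem_erase hy).symm)
  rw [← Finset.prod_erase_mul _ _ hz,
    rootMultiplicity_mul_X_sub_C_pow fun h0 => h (by rw [h0, eval_zero]),
    rootMultiplicity_eq_zero h, zero_add]

/-- Generically, the algebraic multiplicities of the perturbed pencil are as small as the rank of
the perturbation permits, and all new eigenvalues are simple. -/
lemma exists_generic_algMultAt {n l s : ℕ} {A B : Matrix (Fin n) (Fin n) ℂ} (hA : A.IsSymm)
    (hB : B.IsSymm) (hreg : pencilPoly n A B ≠ 0) :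
    ∃ p : MvPolynomial (IdxS l s n) ℂ, p ≠ 0 ∧ ∀ x, MvPolynomial.eval x p ≠ 0 →
      pencilPoly n (A + PhiSymA n l s x) (B + PhiSymB n l s x) ≠ 0 ∧
      (∀ μ, (μ = none ∨ IsEigenvalue n A B μ) →
        algMultAt n (A + PhiSymA n l s x) (B + PhiSymB n l s x) μ
          = sumDrop (l + (s + s)) (pmAt n A B μ)) ∧
      ∀ μ, ¬ IsEigenvalue n A B μ →
        algMultAt n (A + PhiSymA n l s x) (B + PhiSymB n l s x) μ ≤ 1 := by
  classical
  obtain ⟨z₀, hz₀⟩ := exists_eval_ne_zero hreg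
  obtain ⟨w, hw⟩ := exists_rank_perturbation hA hB hz₀ (l + (s + s))
  obtain ⟨x₀, hxA, hxB⟩ := exists_PhiSym_eq z₀ w
  obtain ⟨hw1, hw2, hw3, hw4⟩ := hw _ rfl
  rw [← hxA, ← hxB] at hw1 hw2 hw3 hw4
  obtain ⟨F, hF⟩ := exists_universal_pencilPoly (l := l) (s := s) A B
  set Z := (pencilPoly n A B).roots.toFinset with hZ
  have hmemZ : ∀ z, z ∈ Z ↔ (pencilPoly n A B).eval z = 0 := fun z => by simp [hZ, hreg]
  have hmemZ' : ∀ z, z ∈ Z ↔ IsEigenvalue n A B (some z) := fun z => by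
    rw [hmemZ, isEigenvalue_iff hreg]
    simp [algMultAt, rootMultiplicity_eq_zero_iff, hreg]
  set m : ℂ → ℕ := fun z => sumDrop (l + (s + s)) (pmFin n A B z) with hm
  set q : ℂ[X] := ∏ z ∈ Z, (X - C z) ^ m z with hq
  set k := sumDrop (l + (s + s)) (pmFin n B A 0) with hk
  have hqmon : q.Monic := monic_prod_of_monic _ _ fun z _ => (monic_X_sub_C z).pow _
  have hqZ : ∀ z ∉ Z, q.eval z ≠ 0 := by
    intro z hz
    rw [hq, eval_prod, Finset.prod_ne_zero_iff]
    intro y hy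
    rw [eval_pow, eval_sub, eval_X, eval_C]
    refine pow_ne_zero _ (sub_ne_zero.mpr ?_)
    rintro rfl
    exact hz hy
  have hqroot : ∀ z ∈ Z, q.rootMultiplicity z = m z := fun z hz =>
    rootMultiplicity_prod_X_sub_C_pow m hz
  have hdvd : ∀ x, q ∣ F.map (MvPolynomial.eval x) := by
    intro x
    rw [hF]
    by_cases h0 : pencilPoly n (A + PhiSymA n l s x) (B + PhiSymB n l s x) = 0
    · rw [h0]
      exact dvd_zero q
    · refine Finset.prod_dvd_of_coprime (fun y _ z _ hyz => ?_) fun z _ => ?_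
      · exact (pairwise_coprime_X_sub_C Function.injective_id hyz).pow
      · exact (le_rootMultiplicity_iff h0).mp (sumDrop_le_algMultAt hreg h0 (some z))
  have hnat : ∀ x, pencilPoly n (A + PhiSymA n l s x) (B + PhiSymB n l s x) ≠ 0 →
      k ≤ algMultAt n (A + PhiSymA n l s x) (B + PhiSymB n l s x) none ∧
      algMultAt n (A + PhiSymA n l s x) (B + PhiSymB n l s x) none
        + (pencilPoly n (A + PhiSymA n l s x) (B + PhiSymB n l s x)).natDegree = n :=
    fun x h0 => ⟨sumDrop_le_algMultAt hreg h0 none, rootMultiplicity_swap_add_natDegree h0⟩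
  have hdeg : ∀ x, (F.map (MvPolynomial.eval x)).natDegree ≤ n - k := by
    intro x
    rw [hF]
    by_cases h0 : pencilPoly n (A + PhiSymA n l s x) (B + PhiSymB n l s x) = 0
    · simp [h0]
    · have := hnat x h0
      omega
  obtain ⟨p, hp, hp'⟩ := exists_generic_roots F hqmon Z hqZ hdvd hdeg (x₀ := x₀)
    (fun f => Iff.rfl) (by
      rw [hF]
      refine ⟨hw1, ?_, fun z hz => ?_, fun z hz => hw4 z fun h => hz ((hmemZ z).mpr h)⟩
      · have h1 := rootMultiplicity_swap_add_natDegree hw1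
        rw [hw3] at h1
        omega
      · rw [hqroot z hz, hw2 z ((hmemZ z).mp hz)])
  refine ⟨p, hp, fun x hx => ?_⟩
  obtain ⟨h1, h2, h3, h4⟩ := hp' x hx
  rw [hF] at h1 h2 h3 h4
  have hnone : algMultAt n (A + PhiSymA n l s x) (B + PhiSymB n l s x) none = k := by
    have := hnat x h1
    omega
  refine ⟨h1, fun μ hμ => ?_, fun μ hμ => ?_⟩
  · cases μ with
    | none => exact hnone
    | some z =>
      have hz := (hmemZ' z).mpr (hμ.resolve_left (Option.some_ne_none z))
      exact (h3 z hz).trans (hqroot z hz)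
  · cases μ with
    | none =>
      have h5 : pmFin n B A 0 = 0 := not_not.mp hμ
      rw [hnone, hk, h5]
      simp [sumDrop]
    | some z => exact h4 z fun h => hμ ((hmemZ' z).mp h)

/-- **Generic change under low-rank structure-preserving perturbations of complex
symmetric pencils.** If `L(λ) = A + λB` is a regular symmetric pencil with pairwise
distinct eigenvalues `Λ 1, …, Λ κ` (finite or infinite) with partial multiplicities
`nn i 0 ≥ … ≥ nn i (g i − 1) > 0`, then for `1 ≤ r` and `s ≤ ⌊r/2⌋`, with
`ℓ = r − 2s`, there is a generic set `G_s ⊆ ℂ^{2ℓ+(r+s)n}` such that for all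
`x ∈ G_s`, with `E = Φ_s(x)`: `L + E` is regular; the partial multiplicities of
`L + E` at `Λ i` are exactly `nn i r ≥ … ≥ nn i (g i − 1)`; and every eigenvalue of
`L + E` that is not an eigenvalue of `L` is simple. -/
theorem generic_low_rank_perturbation_symmetric
    (n κ r s : ℕ) (hr : 1 ≤ r) (hs : s ≤ r / 2)
    (A B : Matrix (Fin n) (Fin n) ℂ)
    (hA : A.IsSymm) (hB : B.IsSymm)
    (hreg : PencilRegular n A B)
    (Λ : Fin κ → Option ℂ) (hΛ : Function.Injective Λ)
    (heig : ∀ μ : Option ℂ, IsEigenvalue n A B μ ↔ ∃ i, Λ i = μ)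
    (g : Fin κ → ℕ) (nn : Fin κ → ℕ → ℕ)
    (hmono : ∀ i, ∀ j k : ℕ, j ≤ k → nn i k ≤ nn i j)
    (hgpos : ∀ i, ∀ j : ℕ, 0 < nn i j ↔ j < g i)
    (hpm : ∀ i, pmAt n A B (Λ i) = (Multiset.range (g i)).map (nn i)) :
    ∃ G : Set (IdxS (r - 2 * s) s n → ℂ), IsGenericC (IdxS (r - 2 * s) s n) G ∧
      ∀ x ∈ G,
        PencilRegular n (A + PhiSymA n (r - 2 * s) s x) (B + PhiSymB n (r - 2 * s) s x) ∧
        (∀ i, pmAt n (A + PhiSymA n (r - 2 * s) s x) (B + PhiSymB n (r - 2 * s) s x) (Λ i)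
            = (Multiset.range (g i - r)).map fun j => nn i (r + j)) ∧
        (∀ μ : Option ℂ,
          IsEigenvalue n (A + PhiSymA n (r - 2 * s) s x) (B + PhiSymB n (r - 2 * s) s x) μ →
          ¬ IsEigenvalue n A B μ →
          algMultAt n (A + PhiSymA n (r - 2 * s) s x) (B + PhiSymB n (r - 2 * s) s x) μ = 1) := by
  obtain ⟨p, hp, hp'⟩ := exists_generic_algMultAt (l := r - 2 * s) (s := s) hA hB hreg
  have hrl : r - 2 * s + (s + s) = r := by omega
  refine ⟨{x | MvPolynomial.eval x p ≠ 0}, ⟨{p}, ⟨p, Finset.mem_singleton_self p, hp⟩, ?_⟩,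
    fun x hx => ?_⟩
  · intro x hx q hq
    rw [Finset.mem_singleton.mp hq]
    exact not_not.mp hx
  obtain ⟨h1, h2, h3⟩ := hp' x hx
  refine ⟨h1, fun i => ?_, fun μ hμ hμ' => ?_⟩
  · refine eq_of_cntGE_eq (fun a => pos_of_mem_pmAt) (fun a ha => ?_) fun j => ?_
    · obtain ⟨j, hj, rfl⟩ := Multiset.mem_map.mp ha
      rw [Multiset.mem_range] at hj
      exact (hgpos i _).mpr (by omega)
    · have h4 := h2 (Λ i) (Or.inr ((heig _).mpr ⟨i, rfl⟩))
      rw [← sum_pmAt h1] at h4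
      rw [cntGE_eq_of_sum_eq (cntGE_pmAt_le hreg h1 (Λ i)) h4, hrl, cntGE_map_range (hmono i), hpm]
  · exact le_antisymm (h3 μ hμ') (Nat.one_le_iff_ne_zero.mpr ((isEigenvalue_iff h1 μ).mp hμ))
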